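/- Assume 0 < c < 0.001 and cη ≥ 1/1000. Then there is an absolute constant C (one may take C = 4000) such that every solution (θ, G) of the wave perturbation system with finite X-norms satisfies, for all t ≥ 0, the global stability estimate ‖θ(t)‖_X + ‖G(t)‖_X ≤ C·exp(200·(cη)^{1/3})·(‖θ(0)‖_X + ‖G(0)‖_X). (This is the fixed-frequency form of the Gevrey-3 stability in the main theorem: the growth of the X-norms at frequency η is at most exp(C′·(cη)^{1/3}).) -/

import Mathlib

noncomputable section

open Real MeasureTheory intervalIntegral

/-- The resonant times: `t_k = (1/2)(η/(k+1) + η/k)` for `k ≥ 1` and `t_0 = 2η`. -/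
def tRes (η : ℝ) (k : ℤ) : ℝ :=
  if k = 0 then 2 * η else (η / ((k : ℝ) + 1) + η / (k : ℝ)) / 2

/-- The coefficient `c_l^+(t) = cη(l+1)⁻³(1+(η/(l+1)−t)²)⁻²` (zero if `l+1 = 0`). -/
def cP (c η : ℝ) (l : ℤ) (t : ℝ) : ℝ :=
  if l + 1 = 0 then 0
  else c * η / ((l : ℝ) + 1) ^ 3 * ((1 + (η / ((l : ℝ) + 1) - t) ^ 2) ^ 2)⁻¹

/-- The coefficient `c_l^−(t) = cη(l−1)⁻³(1+(η/(l−1)−t)²)⁻²` (zero if `l−1 = 0`). -/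
def cM (c η : ℝ) (l : ℤ) (t : ℝ) : ℝ :=
  if l - 1 = 0 then 0
  else c * η / ((l : ℝ) - 1) ^ 3 * ((1 + (η / ((l : ℝ) - 1) - t) ^ 2) ^ 2)⁻¹

/-- The coefficient `d_l^+(t) = cη(l+1)⁻³(1+(η/(l+1)−t)²)⁻¹` (zero if `l+1 = 0`). -/
def dP (c η : ℝ) (l : ℤ) (t : ℝ) : ℝ :=
  if l + 1 = 0 then 0
  else c * η / ((l : ℝ) + 1) ^ 3 * (1 + (η / ((l : ℝ) + 1) - t) ^ 2)⁻¹

/-- The coefficient `d_l^−(t) = cη(l−1)⁻³(1+(η/(l−1)−t)²)⁻¹` (zero if `l−1 = 0`). -/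
def dM (c η : ℝ) (l : ℤ) (t : ℝ) : ℝ :=
  if l - 1 = 0 then 0
  else c * η / ((l : ℝ) - 1) ^ 3 * (1 + (η / ((l : ℝ) - 1) - t) ^ 2)⁻¹

/-- Right-hand side of the `θ` equation:
`θ_l′ = c_l⁺θ_{l+1} + c_l⁻θ_{l−1} + d_l⁺G_{l+1} + d_l⁻G_{l−1}`. -/
def thetaRHS (c η : ℝ) (θ G : ℝ → ℤ → ℂ) (l : ℤ) (t : ℝ) : ℂ :=
  (cP c η l t : ℂ) * θ t (l + 1) + (cM c η l t : ℂ) * θ t (l - 1)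
    + (dP c η l t : ℂ) * G t (l + 1) + (dM c η l t : ℂ) * G t (l - 1)

/-- Right-hand side of the `G` equation. -/
def GRHS (ν c η : ℝ) (f : ℝ → ℝ) (θ G : ℝ → ℤ → ℂ) (l : ℤ) (t : ℝ) : ℂ :=
  -((ν * ((l : ℝ) ^ 2 + (η - (l : ℝ) * t) ^ 2) : ℝ) : ℂ) * G t l
    + (f t : ℂ) * (Complex.I * (l : ℂ) / ((2 * c : ℝ) : ℂ)) *
        ((dP c η l t : ℂ) * G t (l + 1) + (dM c η l t : ℂ) * G t (l - 1)
          + (cP c η l t : ℂ) * θ t (l + 1) + (cM c η l t : ℂ) * θ t (l - 1))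
    + ((2 * (η / (l : ℝ) - t) * ((1 + (η / (l : ℝ) - t) ^ 2) ^ 2)⁻¹ : ℝ) : ℂ) * θ t l
    + (((1 + (η / (l : ℝ) - t) ^ 2)⁻¹ : ℝ) : ℂ) *
        ((cP c η l t : ℂ) * θ t (l + 1) + (cM c η l t : ℂ) * θ t (l - 1)
          + (dP c η l t : ℂ) * G t (l + 1) + (dM c η l t : ℂ) * G t (l - 1))

/-- `(θ, G)` is a solution of the wave perturbation system: zero `x`-average modes, and
each nonzero mode satisfies the coupled ODE system. -/
def IsWaveSol (ν c η : ℝ) (f : ℝ → ℝ) (θ G : ℝ → ℤ → ℂ) : Prop :=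
  (∀ t, θ t 0 = 0) ∧ (∀ t, G t 0 = 0) ∧
    ∀ l : ℤ, l ≠ 0 → ∀ t : ℝ,
      HasDerivAt (fun s => θ s l) (thetaRHS c η θ G l t) t ∧
      HasDerivAt (fun s => G s l) (GRHS ν c η f θ G l t) t

/-- The weighted `ℓ²`-norm `‖u‖_X = (∑ λ(l)²|u_l|²)^{1/2}`. -/
def Xnorm (lam : ℤ → ℝ) (u : ℤ → ℂ) : ℝ :=
  Real.sqrt (∑' l : ℤ, (lam l) ^ 2 * ‖u l‖ ^ 2)

/-- Admissible weight: positive with `λ(l±1) < 2λ(l)`. -/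
def GoodWeight (lam : ℤ → ℝ) : Prop :=
  (∀ l, 0 < lam l) ∧ (∀ l, lam (l + 1) < 2 * lam l) ∧ (∀ l, lam (l - 1) < 2 * lam l)

/-- The size `b/|k|³` of the forcing exerted by mode `k` at its resonance. -/
def forcing (b : ℝ) (k : ℤ) : ℝ := b / |(k : ℝ)| ^ 3

/-- A primitive of a majorant of `κ(1+x²)^{-1/2}(1+κ²+x²)^{-1/2}`. -/
def resPrim (κ x : ℝ) : ℝ :=
  κ / √(1 + κ ^ 2) * (arsinh x - arsinh (x / √(1 + κ ^ 2)) + arctan (x / √(1 + κ ^ 2)))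

/-- The derivative of `resPrim κ`. -/
def resDens (κ x : ℝ) : ℝ :=
  κ / √(1 + κ ^ 2) * ((√(1 + x ^ 2))⁻¹ - (√(1 + κ ^ 2 + x ^ 2))⁻¹
    + √(1 + κ ^ 2) / (1 + κ ^ 2 + x ^ 2))

lemma hasDerivAt_resPrim (κ x : ℝ) : HasDerivAt (resPrim κ) (resDens κ x) x := by
  have hR : 0 < 1 + κ ^ 2 := by positivity
  have hR' : 0 < √(1 + κ ^ 2) := Real.sqrt_pos.2 hR
  have hdiv : HasDerivAt (fun y : ℝ => y / √(1 + κ ^ 2)) (1 / √(1 + κ ^ 2)) x :=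
    (hasDerivAt_id x).div_const _
  have h1 := (((hasDerivAt_arsinh x).sub hdiv.arsinh).add hdiv.arctan).const_mul
    (κ / √(1 + κ ^ 2))
  refine h1.congr_deriv ?_
  unfold resDens
  have e1 : 1 + (x / √(1 + κ ^ 2)) ^ 2 = (1 + κ ^ 2 + x ^ 2) / (1 + κ ^ 2) := by
    rw [div_pow, Real.sq_sqrt hR.le]; field_simp
  congr 2
  · congr 1
    rw [e1, Real.sqrt_div (by positivity), smul_eq_mul]
    have : 0 < √(1 + κ ^ 2 + x ^ 2) := Real.sqrt_pos.2 (by positivity)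
    field_simp
  · rw [e1]
    field_simp
    rw [Real.sq_sqrt hR.le]

lemma le_resDens {κ : ℝ} (hκ : 0 ≤ κ) (x : ℝ) :
    κ / (√(1 + x ^ 2) * √(1 + κ ^ 2 + x ^ 2)) ≤ resDens κ x := by
  unfold resDens
  have hR : 0 < √(1 + κ ^ 2) := Real.sqrt_pos.2 (by positivity)
  have hX : 0 < √(1 + x ^ 2) := Real.sqrt_pos.2 (by positivity)
  have hY : 0 < √(1 + κ ^ 2 + x ^ 2) := Real.sqrt_pos.2 (by positivity)
  have hRY : √(1 + κ ^ 2) ≤ √(1 + κ ^ 2 + x ^ 2) := Real.sqrt_le_sqrt (by nlinarith [sq_nonneg x])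
  have hXY : √(1 + x ^ 2) ≤ √(1 + κ ^ 2 + x ^ 2) := Real.sqrt_le_sqrt (by nlinarith [sq_nonneg κ])
  have hYY : (√(1 + κ ^ 2 + x ^ 2)) ^ 2 = 1 + κ ^ 2 + x ^ 2 := Real.sq_sqrt (by positivity)
  rw [← hYY, Real.sqrt_sq hY.le]
  generalize √(1 + κ ^ 2) = R at *
  generalize √(1 + κ ^ 2 + x ^ 2) = Y at *
  generalize √(1 + x ^ 2) = X at *
  have : κ / R * (X⁻¹ - Y⁻¹ + R / Y ^ 2) - κ / (X * Y)
      = κ * ((Y - R) * (Y - X)) / (R * X * Y ^ 2) := by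
    field_simp; ring
  have h2 : 0 ≤ κ * ((Y - R) * (Y - X)) / (R * X * Y ^ 2) :=
    div_nonneg (mul_nonneg hκ (mul_nonneg (by linarith) (by linarith))) (by positivity)
  linarith

lemma resDens_le {κ : ℝ} (hκ : 0 ≤ κ) (x : ℝ) : resDens κ x ≤ 2 * κ := by
  unfold resDens
  have hR : 1 ≤ √(1 + κ ^ 2) := Real.one_le_sqrt.2 (by nlinarith [sq_nonneg κ])
  have hX : 1 ≤ √(1 + x ^ 2) := Real.one_le_sqrt.2 (by nlinarith [sq_nonneg x])
  have hY : 0 ≤ (√(1 + κ ^ 2 + x ^ 2))⁻¹ := by positivity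
  have hRR : √(1 + κ ^ 2) ≤ 1 + κ ^ 2 + x ^ 2 := by
    have := Real.sq_sqrt (show 0 ≤ 1 + κ ^ 2 by positivity)
    nlinarith [sq_nonneg x]
  have h1 : (√(1 + x ^ 2))⁻¹ ≤ 1 := inv_le_one_of_one_le₀ hX
  have h2 : √(1 + κ ^ 2) / (1 + κ ^ 2 + x ^ 2) ≤ 1 := div_le_one_of_le₀ hRR (by positivity)
  have h3 : κ / √(1 + κ ^ 2) ≤ κ := div_le_self hκ hR
  have h4 : 0 ≤ κ / √(1 + κ ^ 2) := by positivity
  nlinarith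

lemma arsinh_le_arsinh_div_add_log {R : ℝ} (hR : 1 ≤ R) (x : ℝ) :
    arsinh x ≤ arsinh (x / R) + log R := by
  have hR0 : 0 < R := by linarith
  rw [← Real.exp_le_exp, Real.exp_add, Real.exp_log hR0, Real.exp_arsinh, Real.exp_arsinh, add_mul,
    div_mul_cancel₀ _ hR0.ne']
  have : √(1 + x ^ 2) ≤ √(1 + (x / R) ^ 2) * R := by
    apply Real.sqrt_le_iff.2 ⟨by positivity, ?_⟩
    rw [mul_pow, Real.sq_sqrt (by positivity)]
    field_simp
    nlinarith
  linarith

lemma abs_arsinh_sub_le {R : ℝ} (hR : 1 ≤ R) (x : ℝ) :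
    |arsinh x - arsinh (x / R)| ≤ log R := by
  have h1 := arsinh_le_arsinh_div_add_log hR x
  have h2 := arsinh_le_arsinh_div_add_log hR (-x)
  rw [neg_div, arsinh_neg, arsinh_neg] at h2
  exact abs_le.2 ⟨by linarith, by linarith⟩

lemma resPrim_sub_le {κ : ℝ} (hκ : 0 ≤ κ) (x y : ℝ) :
    resPrim κ x - resPrim κ y ≤ κ / √(1 + κ ^ 2) * (log (1 + κ ^ 2) + π) := by
  unfold resPrim
  rw [← mul_sub]
  have hR : 1 ≤ √(1 + κ ^ 2) := Real.one_le_sqrt.2 (by nlinarith [sq_nonneg κ])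
  refine mul_le_mul_of_nonneg_left ?_ (by positivity)
  have h1 := abs_le.1 (abs_arsinh_sub_le hR x)
  have h2 := abs_le.1 (abs_arsinh_sub_le hR y)
  rw [Real.log_sqrt (by positivity)] at h1 h2
  have h3 := arctan_lt_pi_div_two (x / √(1 + κ ^ 2))
  have h4 := neg_pi_div_two_lt_arctan (y / √(1 + κ ^ 2))
  linarith [h1.2, h2.1]

lemma resTotal_le_pi_mul {κ : ℝ} (hκ : 0 ≤ κ) :
    κ / √(1 + κ ^ 2) * (log (1 + κ ^ 2) + π) ≤ π * κ := by
  have hR : 1 ≤ √(1 + κ ^ 2) := Real.one_le_sqrt.2 (by nlinarith [sq_nonneg κ])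
  have h1 : log (1 + κ ^ 2) ≤ π * (√(1 + κ ^ 2) - 1) := by
    have := Real.log_le_sub_one_of_pos (lt_of_lt_of_le one_pos hR)
    rw [Real.log_sqrt (by positivity)] at this
    nlinarith [Real.pi_gt_three]
  rw [div_mul_eq_mul_div, div_le_iff₀ (by linarith)]
  nlinarith

lemma resTotal_le_log (κ : ℝ) :
    κ / √(1 + κ ^ 2) * (log (1 + κ ^ 2) + π) ≤ π + log (1 + κ ^ 2) := by
  have h1 : κ / √(1 + κ ^ 2) ≤ 1 :=
    div_le_one_of_le₀ (Real.le_sqrt_of_sq_le (by linarith)) (by positivity)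
  have h2 : 0 ≤ log (1 + κ ^ 2) := Real.log_nonneg (by nlinarith [sq_nonneg κ])
  have := mul_le_mul_of_nonneg_right h1 (show 0 ≤ log (1 + κ ^ 2) + π by positivity)
  linarith

lemma arctan_sub_arctan_le {x y : ℝ} (hy : 0 < y) : arctan x - arctan y ≤ 1 / y := by
  have h1 := arctan_inv_of_pos hy
  have h2 := arctan_lt_pi_div_two x
  have h3 : arctan y⁻¹ ≤ y⁻¹ := by
    have h := Real.lt_tan (Real.arctan_pos.2 (inv_pos.2 hy)) (arctan_lt_pi_div_two _)
    rw [tan_arctan] at h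
    exact h.le
  rw [one_div]
  linarith

lemma sum_range_inv_sqrt_le (n : ℕ) : ∑ k ∈ Finset.range n, 1 / √((k : ℝ) + 1) ≤ 2 * √n := by
  induction n with
  | zero => simp
  | succ n ih =>
    rw [Finset.sum_range_succ]
    have h1 : 0 < √((n : ℝ) + 1) := Real.sqrt_pos.2 (by positivity)
    have h2 : √((n : ℝ) + 1) ^ 2 = n + 1 := Real.sq_sqrt (by positivity)
    have h3 : √(n : ℝ) ^ 2 = n := Real.sq_sqrt (by positivity)
    have h4 : 0 ≤ √(n : ℝ) := Real.sqrt_nonneg _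
    have : 1 / √((n : ℝ) + 1) ≤ 2 * √((n : ℝ) + 1) - 2 * √n := by
      rw [div_le_iff₀ h1]
      nlinarith [sq_nonneg (√((n : ℝ) + 1) - √n)]
    push_cast
    linarith

lemma log_le_sqrt {y : ℝ} (hy : 0 < y) : log y ≤ 0.7359 * √y := by
  have hs : 0 < √y := Real.sqrt_pos.2 hy
  have h := Real.log_le_sub_one_of_pos (div_pos hs (Real.exp_pos 1))
  rw [Real.log_div hs.ne' (Real.exp_pos 1).ne', Real.log_exp, Real.log_sqrt hy.le] at h
  have h2 : √y / exp 1 ≤ 0.36794 * √y := by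
    rw [div_le_iff₀ (Real.exp_pos 1)]
    have := Real.exp_one_gt_d9
    nlinarith
  nlinarith

lemma resTotal_le_of_le {B k : ℝ} (hk : 0 < k) (hkB : k ≤ B) :
    π + log (1 + ((B ^ 3) / k ^ 3) ^ 2) ≤ 3.84 + 4.4154 * √B * (1 / √k) := by
  have hB : 0 < B := hk.trans_le hkB
  have h1 : 1 ≤ B / k := (one_le_div hk).2 hkB
  have h2 : 1 + ((B ^ 3) / k ^ 3) ^ 2 ≤ 2 * (B / k) ^ 6 := by
    have : ((B ^ 3) / k ^ 3) ^ 2 = (B / k) ^ 6 := by rw [← div_pow]; ring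
    rw [this]
    linarith [one_le_pow₀ h1 (n := 6)]
  have h3 := Real.log_le_log (by positivity) h2
  rw [Real.log_mul (by norm_num) (by positivity), Real.log_pow] at h3
  have h4 := log_le_sqrt (div_pos hB hk)
  rw [Real.sqrt_div hB.le] at h4
  have h5 : √B * (1 / √k) = √B / √k := by ring
  have := Real.log_two_lt_d9
  have := Real.pi_lt_d4
  rw [mul_assoc, h5]
  push_cast at h3
  linarith

lemma inv_cube_le {k : ℝ} (hk : 1 ≤ k) :
    1 / k ^ 3 ≤ 1 / (2 * (k - 1 / 2) ^ 2) - 1 / (2 * (k + 1 / 2) ^ 2) := by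
  have h1 : 0 < k - 1 / 2 := by linarith
  have h2 : 0 < k + 1 / 2 := by linarith
  rw [div_sub_div _ _ (by positivity) (by positivity),
    div_le_div_iff₀ (by positivity) (by positivity)]
  have : 0 ≤ k ^ 2 := by positivity
  nlinarith

lemma sum_range_resTotal_le {B : ℝ} (hB : 0 < B) (n : ℕ) :
    ∑ k ∈ Finset.range n, (B ^ 3 / ((k : ℝ) + 1) ^ 3) / √(1 + (B ^ 3 / ((k : ℝ) + 1) ^ 3) ^ 2)
      * (log (1 + (B ^ 3 / ((k : ℝ) + 1) ^ 3) ^ 2) + π) ≤ 19 * B := by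
  set φ : ℕ → ℝ := fun k => (B ^ 3 / ((k : ℝ) + 1) ^ 3) /
      √(1 + (B ^ 3 / ((k : ℝ) + 1) ^ 3) ^ 2)
      * (log (1 + (B ^ 3 / ((k : ℝ) + 1) ^ 3) ^ 2) + π) with hφ
  have hlow : ∀ m : ℕ, (m : ℝ) ≤ B → ∑ k ∈ Finset.range m, φ k ≤ 12.6708 * B := by
    intro m hm
    have h1 : ∑ k ∈ Finset.range m, φ k
        ≤ ∑ k ∈ Finset.range m, (3.84 + 4.4154 * √B * (1 / √((k : ℝ) + 1))) := by
      refine Finset.sum_le_sum fun k hk => ?_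
      have hk' : (k : ℝ) + 1 ≤ m := by exact_mod_cast Finset.mem_range.1 hk
      exact (resTotal_le_log _).trans
        (resTotal_le_of_le (by positivity) (hk'.trans hm))
    rw [Finset.sum_add_distrib, ← Finset.mul_sum] at h1
    simp only [Finset.sum_const, Finset.card_range, nsmul_eq_mul] at h1
    have h2 := sum_range_inv_sqrt_le m
    have h3 : √(m : ℝ) ≤ √B := Real.sqrt_le_sqrt hm
    have h4 : √B * √B = B := Real.mul_self_sqrt hB.le
    have h5 : 0 ≤ √B := Real.sqrt_nonneg B
    have h6 : √B * ∑ k ∈ Finset.range m, 1 / √((k : ℝ) + 1) ≤ 2 * B := by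
      calc √B * ∑ k ∈ Finset.range m, 1 / √((k : ℝ) + 1) ≤ √B * (2 * √B) :=
            mul_le_mul_of_nonneg_left (by linarith) h5
        _ = 2 * B := by linarith
    nlinarith
  rcases le_total (n : ℝ) B with hn | hn
  · exact (hlow n hn).trans (by linarith)
  · set K := ⌊B⌋₊ with hK
    have hKB : (K : ℝ) ≤ B := Nat.floor_le hB.le
    have hBK : B < K + 1 := Nat.lt_floor_add_one B
    have hKn : K ≤ n := by exact_mod_cast hKB.trans hn
    have htail : ∀ m : ℕ, K ≤ m → ∑ k ∈ Finset.range m, φ k ≤ 12.6708 * B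
        + π * B ^ 3 * (1 / (2 * ((K : ℝ) + 1 / 2) ^ 2) - 1 / (2 * ((m : ℝ) + 1 / 2) ^ 2)) := by
      intro m hm
      induction m, hm using Nat.le_induction with
      | base => simpa using hlow K hKB
      | succ m hm ih =>
        rw [Finset.sum_range_succ]
        have h1 : φ m ≤ π * (B ^ 3 / ((m : ℝ) + 1) ^ 3) := resTotal_le_pi_mul (by positivity)
        have h2 := inv_cube_le (k := (m : ℝ) + 1) (by linarith [Nat.cast_nonneg (α := ℝ) m])
        have h3 := mul_le_mul_of_nonneg_left h2 (show 0 ≤ π * B ^ 3 by positivity)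
        have e1 : (m : ℝ) + 1 - 1 / 2 = m + 1 / 2 := by ring
        rw [e1] at h3
        have e2 : π * B ^ 3 * (1 / ((m : ℝ) + 1) ^ 3) = π * (B ^ 3 / ((m : ℝ) + 1) ^ 3) := by ring
        push_cast
        linarith
    have h1 := htail n hKn
    have h2 : 1 / (2 * ((K : ℝ) + 1 / 2) ^ 2) ≤ 2 / B ^ 2 := by
      rw [div_le_div_iff₀ (by positivity) (by positivity)]
      nlinarith [Nat.cast_nonneg (α := ℝ) K]
    have h3 : 0 ≤ 1 / (2 * ((n : ℝ) + 1 / 2) ^ 2) := by positivity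
    have h4 : π * B ^ 3 * (1 / (2 * ((K : ℝ) + 1 / 2) ^ 2) - 1 / (2 * ((n : ℝ) + 1 / 2) ^ 2))
        ≤ π * B ^ 3 * (2 / B ^ 2) :=
      mul_le_mul_of_nonneg_left (by linarith) (by positivity)
    have h5 : π * B ^ 3 * (2 / B ^ 2) = 2 * π * B := by field_simp
    have := Real.pi_lt_d4
    nlinarith

/-- A Grönwall inequality for the supremum `E` of a directed family of differentiable
functions whose derivatives are controlled by `E` itself. -/
lemma gronwall_of_isLUB {ι : Type*} {F F' : ι → ℝ → ℝ} {E Φ K : ℝ → ℝ} {T C : ℝ}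
    (hT : 0 ≤ T) (hE0 : ∀ t, 0 ≤ E t) (hEC : ∀ t ∈ Set.Icc 0 T, E t ≤ C)
    (hlub : ∀ t, IsLUB (Set.range fun i => F i t) (E t))
    (hF : ∀ i t, HasDerivAt (F i) (F' i t) t)
    (hF' : ∀ i, ∀ t, 0 ≤ t → F' i t ≤ K t * E t)
    (hΦ : ∀ t, HasDerivAt Φ (K t) t) (hK : ∀ t, 0 ≤ K t) (hΦ0 : Φ 0 = 0) :
    E T ≤ rexp (Φ T) * E 0 := by
  have hmono : Monotone Φ := monotone_of_deriv_nonneg (fun t => (hΦ t).differentiableAt)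
    (fun t => by rw [(hΦ t).deriv]; exact hK t)
  have hΦnn : ∀ t, 0 ≤ t → 0 ≤ Φ t := fun t ht => hΦ0 ▸ hmono ht
  set S : Set ℝ := (fun t => E t * rexp (-Φ t)) '' Set.Icc 0 T with hS
  have hSne : S.Nonempty := ⟨_, 0, ⟨le_rfl, hT⟩, rfl⟩
  have hSbdd : BddAbove S := by
    refine ⟨C, ?_⟩
    rintro _ ⟨t, ht, rfl⟩
    have h1 : rexp (-Φ t) ≤ 1 := Real.exp_le_one_iff.2 (by linarith [hΦnn t ht.1])
    exact (mul_le_of_le_one_right (hE0 t) h1).trans (hEC t ht)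
  set M := sSup S with hM
  have hEM : ∀ t ∈ Set.Icc 0 T, E t ≤ M * rexp (Φ t) := by
    intro t ht
    have h1 : E t * rexp (-Φ t) ≤ M := le_csSup hSbdd ⟨t, ht, rfl⟩
    have h2 := mul_le_mul_of_nonneg_right h1 (Real.exp_pos (Φ t)).le
    rwa [mul_assoc, ← Real.exp_add, neg_add_cancel, Real.exp_zero, mul_one] at h2
  have hFi : ∀ t ∈ Set.Icc 0 T, E t ≤ E 0 + M * (rexp (Φ t) - 1) := by
    intro t ht
    refine (hlub t).2 ?_
    rintro _ ⟨i, rfl⟩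
    have hanti : AntitoneOn (fun s => F i s - M * rexp (Φ s)) (Set.Icc 0 T) := by
      have hd : ∀ s, HasDerivAt (fun s => F i s - M * rexp (Φ s))
          (F' i s - M * (rexp (Φ s) * K s)) s :=
        fun s => (hF i s).sub ((hΦ s).exp.const_mul M)
      refine antitoneOn_of_deriv_nonpos (convex_Icc 0 T)
        (fun s _ => (hd s).continuousAt.continuousWithinAt)
        (fun s _ => (hd s).differentiableAt.differentiableWithinAt) ?_
      intro s hs
      rw [interior_Icc] at hs
      rw [(hd s).deriv]
      have h1 := hF' i s hs.1.le
      have h2 := mul_le_mul_of_nonneg_left (hEM s ⟨hs.1.le, hs.2.le⟩) (hK s)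
      linarith
    have h1 := hanti ⟨le_rfl, hT⟩ ht ht.1
    have h2 : F i 0 ≤ E 0 := (hlub 0).1 ⟨i, rfl⟩
    simp only [hΦ0, Real.exp_zero, mul_one] at h1
    change F i t ≤ _
    linarith
  have hM0 : M ≤ E 0 := by
    by_contra! hlt
    have : M ≤ M - rexp (-Φ T) * (M - E 0) := by
      refine csSup_le hSne ?_
      rintro _ ⟨t, ht, rfl⟩
      have h1 := mul_le_mul_of_nonneg_right (hFi t ht) (Real.exp_pos (-Φ t)).le
      have h2 : rexp (Φ t) * rexp (-Φ t) = 1 := by rw [← Real.exp_add]; simp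
      have h3 : rexp (-Φ T) ≤ rexp (-Φ t) := Real.exp_le_exp.2 (by linarith [hmono ht.2])
      have h4 := mul_le_mul_of_nonneg_right h3 (show 0 ≤ M - E 0 by linarith)
      have h5 : (E 0 + M * (rexp (Φ t) - 1)) * rexp (-Φ t)
          = M - rexp (-Φ t) * (M - E 0) := by
        linear_combination M * h2
      change E t * rexp (-Φ t) ≤ _
      linarith
    have := mul_pos (Real.exp_pos (-Φ T)) (show 0 < M - E 0 by linarith)
    linarith
  have h1 := hEM T ⟨hT, le_rfl⟩
  have h2 := mul_le_mul_of_nonneg_right hM0 (Real.exp_pos (Φ T)).le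
  linarith

/-- The interaction sum of a nearest-neighbour chain on `ℤ`, driven by rates `r`. -/
lemma sum_neighbour_le {e r : ℤ → ℝ} {α β γ E : ℝ} (he : ∀ l, 0 ≤ e l) (hr : ∀ l, 0 ≤ r l)
    (hα : 0 ≤ α) (hβ : 0 ≤ β) (hγ : 0 ≤ γ) (hrs : Summable r)
    (hE : HasSum (fun l => e l ^ 2) E) (s : Finset ℤ) :
    ∑ l ∈ s, (2 * r l * e l ^ 2
        + (α * r (l + 1) + β * r l + γ) * (e l * e (l + 1))
        + (α * r (l - 1) + β * r l + γ) * (e l * e (l - 1)))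
      ≤ ((2 + 0.71 * (α + β)) * ∑' l, r l + 2 * γ) * E := by
  have hle : ∀ t : Finset ℤ, ∑ l ∈ t, e l ^ 2 ≤ E := fun t =>
    sum_le_hasSum t (fun l _ => sq_nonneg _) hE
  have hEp : HasSum (fun l => e (l + 1) ^ 2) E :=
    (Equiv.hasSum_iff (Equiv.addRight (1 : ℤ)) (f := fun l => e l ^ 2)).2 hE
  have hEm : HasSum (fun l => e (l - 1) ^ 2) E :=
    (Equiv.hasSum_iff (Equiv.subRight (1 : ℤ)) (f := fun l => e l ^ 2)).2 hE
  have hE0 : 0 ≤ E := hE.nonneg fun l => sq_nonneg _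
  have hsq : ∀ l, e l ^ 2 ≤ E := fun l => by simpa using hle {l}
  have hthree : ∀ l, e l ^ 2 + e (l + 1) ^ 2 + e (l - 1) ^ 2 ≤ E := by
    intro l
    have h := hle {l, l + 1, l - 1}
    rw [Finset.sum_insert (by simp; omega), Finset.sum_insert (by simp; omega),
      Finset.sum_singleton] at h
    linarith
  have hP : ∀ l, e l * (e (l + 1) + e (l - 1)) ≤ 0.71 * E := by
    intro l
    nlinarith [hthree l, sq_nonneg (e l - 0.71 * (e (l + 1) + e (l - 1))),
      sq_nonneg (e (l + 1) - e (l - 1)), sq_nonneg (e (l + 1) + e (l - 1))]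
  have hP0 : ∀ l, 0 ≤ e l * (e (l + 1) + e (l - 1)) := fun l =>
    mul_nonneg (he l) (add_nonneg (he _) (he _))
  have hprod : ∀ l k, e l * e k ≤ E := fun l k => by
    nlinarith [hsq l, hsq k, sq_nonneg (e l - e k)]
  have hbound : ∀ t : Finset ℤ, ∑ l ∈ t, r l ≤ ∑' l, r l := fun t =>
    hrs.sum_le_tsum t fun l _ => hr l
  have h1 : ∑ l ∈ s, r l * e l ^ 2 ≤ (∑' l, r l) * E := by
    calc _ ≤ ∑ l ∈ s, r l * E :=
          Finset.sum_le_sum fun l _ => mul_le_mul_of_nonneg_left (hsq l) (hr l)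
      _ = (∑ l ∈ s, r l) * E := (Finset.sum_mul ..).symm
      _ ≤ _ := mul_le_mul_of_nonneg_right (hbound s) hE0
  have h2 : ∑ l ∈ s, r l * (e l * (e (l + 1) + e (l - 1))) ≤ (∑' l, r l) * (0.71 * E) := by
    calc _ ≤ ∑ l ∈ s, r l * (0.71 * E) :=
          Finset.sum_le_sum fun l _ => mul_le_mul_of_nonneg_left (hP l) (hr l)
      _ = (∑ l ∈ s, r l) * (0.71 * E) := (Finset.sum_mul ..).symm
      _ ≤ _ := mul_le_mul_of_nonneg_right (hbound s) (by positivity)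
  have hu : Summable fun k => r k * (e k * e (k - 1)) :=
    Summable.of_nonneg_of_le (fun k => mul_nonneg (hr k) (mul_nonneg (he _) (he _)))
      (fun k => mul_le_mul_of_nonneg_left (hprod _ _) (hr k)) (hrs.mul_right E)
  have hv : Summable fun k => r k * (e k * e (k + 1)) :=
    Summable.of_nonneg_of_le (fun k => mul_nonneg (hr k) (mul_nonneg (he _) (he _)))
      (fun k => mul_le_mul_of_nonneg_left (hprod _ _) (hr k)) (hrs.mul_right E)
  have hu' : HasSum (fun l => r (l + 1) * (e (l + 1) * e l)) (∑' k, r k * (e k * e (k - 1))) := by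
    have := (Equiv.hasSum_iff (Equiv.addRight (1 : ℤ))).2 hu.hasSum
    simpa [Function.comp_def] using this
  have hv' : HasSum (fun l => r (l - 1) * (e (l - 1) * e l)) (∑' k, r k * (e k * e (k + 1))) := by
    have := (Equiv.hasSum_iff (Equiv.subRight (1 : ℤ))).2 hv.hasSum
    simpa [Function.comp_def] using this
  have h3 : ∑ l ∈ s, (r (l + 1) * (e (l + 1) * e l) + r (l - 1) * (e (l - 1) * e l))
      ≤ (∑' l, r l) * (0.71 * E) := by
    calc _ ≤ ∑' k, r k * (e k * e (k - 1)) + ∑' k, r k * (e k * e (k + 1)) :=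
          sum_le_hasSum s (fun l _ => add_nonneg
            (mul_nonneg (hr _) (mul_nonneg (he _) (he _)))
            (mul_nonneg (hr _) (mul_nonneg (he _) (he _)))) (hu'.add hv')
      _ = ∑' k, (r k * (e k * e (k - 1)) + r k * (e k * e (k + 1))) := (hu.tsum_add hv).symm
      _ ≤ ∑' k, r k * (0.71 * E) := by
          refine (hu.add hv).tsum_le_tsum (fun k => ?_) (hrs.mul_right _)
          rw [← mul_add]
          exact mul_le_mul_of_nonneg_left (by linarith [hP k]) (hr k)
      _ = _ := tsum_mul_right
  have h4 : ∑ l ∈ s, e l * (e (l + 1) + e (l - 1)) ≤ 2 * E := by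
    calc _ ≤ ∑ l ∈ s, (e l ^ 2 + 1 / 2 * e (l + 1) ^ 2 + 1 / 2 * e (l - 1) ^ 2) :=
          Finset.sum_le_sum fun l _ => by
            nlinarith [sq_nonneg (e l - e (l + 1)), sq_nonneg (e l - e (l - 1))]
      _ ≤ E + 1 / 2 * E + 1 / 2 * E :=
          sum_le_hasSum s (fun l _ => by positivity)
            ((hE.add (hEp.mul_left (1 / 2))).add (hEm.mul_left (1 / 2)))
      _ = 2 * E := by ring
  have hsplit : ∑ l ∈ s, (2 * r l * e l ^ 2
        + (α * r (l + 1) + β * r l + γ) * (e l * e (l + 1))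
        + (α * r (l - 1) + β * r l + γ) * (e l * e (l - 1)))
      = 2 * ∑ l ∈ s, r l * e l ^ 2
        + α * ∑ l ∈ s, (r (l + 1) * (e (l + 1) * e l) + r (l - 1) * (e (l - 1) * e l))
        + β * ∑ l ∈ s, r l * (e l * (e (l + 1) + e (l - 1)))
        + γ * ∑ l ∈ s, e l * (e (l + 1) + e (l - 1)) := by
    simp only [Finset.mul_sum, ← Finset.sum_add_distrib]
    exact Finset.sum_congr rfl fun l _ => by ring
  rw [hsplit]
  nlinarith [mul_le_mul_of_nonneg_left h2 hβ, mul_le_mul_of_nonneg_left h3 hα,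
    mul_le_mul_of_nonneg_left h4 hγ]

/-- The Lorentzian profile of mode `k` around its resonant time `η/k`. -/
def lorentz (η : ℝ) (k : ℤ) (t : ℝ) : ℝ := (1 + (η / (k : ℝ) - t) ^ 2)⁻¹

/-- The square of the resonance-adapted amplitude weight of mode `k`. -/
def ampSq (b η : ℝ) (k : ℤ) (t : ℝ) : ℝ := 1 + forcing b k ^ 2 * lorentz η k t

/-- The growth rate caused by mode `k` relative to its amplitude weight. -/
def resRate (b η : ℝ) (k : ℤ) (t : ℝ) : ℝ :=
  forcing b k * lorentz η k t / √(ampSq b η k t)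

lemma forcing_nonneg {b : ℝ} (hb : 0 ≤ b) (k : ℤ) : 0 ≤ forcing b k := by
  unfold forcing; positivity

lemma lorentz_pos (η : ℝ) (k : ℤ) (t : ℝ) : 0 < lorentz η k t := by
  unfold lorentz; positivity

lemma lorentz_le_one (η : ℝ) (k : ℤ) (t : ℝ) : lorentz η k t ≤ 1 :=
  inv_le_one_of_one_le₀ (by nlinarith [sq_nonneg (η / (k : ℝ) - t)])

lemma one_le_ampSq (b η : ℝ) (k : ℤ) (t : ℝ) : 1 ≤ ampSq b η k t := by
  have := lorentz_pos η k t
  unfold ampSq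
  nlinarith [mul_nonneg (sq_nonneg (forcing b k)) this.le]

lemma one_le_sqrt_ampSq (b η : ℝ) (k : ℤ) (t : ℝ) : 1 ≤ √(ampSq b η k t) :=
  Real.one_le_sqrt.2 (one_le_ampSq b η k t)

lemma sq_sqrt_ampSq (b η : ℝ) (k : ℤ) (t : ℝ) : √(ampSq b η k t) ^ 2 = ampSq b η k t :=
  Real.sq_sqrt (by linarith [one_le_ampSq b η k t])

lemma resRate_nonneg {b : ℝ} (hb : 0 ≤ b) (η : ℝ) (k : ℤ) (t : ℝ) : 0 ≤ resRate b η k t :=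
  div_nonneg (mul_nonneg (forcing_nonneg hb k) (lorentz_pos η k t).le) (Real.sqrt_nonneg _)

lemma resRate_le {b : ℝ} (hb : 0 ≤ b) (η : ℝ) (k : ℤ) (t : ℝ) :
    resRate b η k t ≤ forcing b k * lorentz η k t :=
  div_le_self (mul_nonneg (forcing_nonneg hb k) (lorentz_pos η k t).le)
    (one_le_sqrt_ampSq b η k t)

lemma resRate_mul_sqrt (b η : ℝ) (k : ℤ) (t : ℝ) :
    resRate b η k t * √(ampSq b η k t) = forcing b k * lorentz η k t :=
  div_mul_cancel₀ _ (by linarith [one_le_sqrt_ampSq b η k t])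

lemma one_le_abs_cast {k : ℤ} (hk : k ≠ 0) : 1 ≤ |(k : ℝ)| := by
  exact_mod_cast Int.one_le_abs hk

/-- Resonances of adjacent modes are separated, so adjacent amplitude weights are not large
simultaneously. -/
lemma sqrt_ampSq_mul_resRate_le {c η : ℝ} (hc : 0 < c) (hc' : c < 0.001) (hη : 0 < η)
    {l k : ℤ} (hl : l ≠ 0) (hk : k ≠ 0) (hlk : |(l : ℝ) - k| = 1) (t : ℝ) :
    √(ampSq (c * η) η l t) * resRate (c * η) η k t
      ≤ 1.12 * resRate (c * η) η k t + 0.00001 * resRate (c * η) η l t := by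
  have hb : 0 ≤ c * η := by positivity
  have hrk := resRate_nonneg hb η k t
  have hrl := resRate_nonneg hb η l t
  have hw := lorentz_pos η l t
  rcases le_or_gt (forcing (c * η) l ^ 2 * lorentz η l t) (1 / 4) with h | h
  · have h1 : √(ampSq (c * η) η l t) ≤ 1.12 := by
      apply Real.sqrt_le_iff.2 ⟨by norm_num, ?_⟩
      unfold ampSq
      norm_num
      linarith
    nlinarith
  · have hL := one_le_abs_cast hl
    have hK := one_le_abs_cast hk
    have hKL : |(k : ℝ)| ≤ 2 * |(l : ℝ)| := by
      have := abs_sub_abs_le_abs_sub (k : ℝ) l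
      rw [abs_sub_comm] at this
      linarith
    have hl0 : (l : ℝ) ≠ 0 := by exact_mod_cast hl
    have hk0 : (k : ℝ) ≠ 0 := by exact_mod_cast hk
    set D : ℝ := η / (|(l : ℝ)| * |(k : ℝ)|) with hD
    have hDpos : 0 < D := by positivity
    have hDabs : |η / (l : ℝ) - η / k| = D := by
      rw [div_sub_div _ _ hl0 hk0, abs_div, abs_mul, show η * (k : ℝ) - l * η = η * (k - l) by ring,
        abs_mul, abs_sub_comm, hlk, abs_of_pos hη, mul_one]
    have hκl : forcing (c * η) l ≤ 2 * c * D := by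
      unfold forcing
      rw [hD, mul_div_assoc', div_le_div_iff₀ (by positivity) (by positivity)]
      have h2 : |(k : ℝ)| ≤ 2 * |(l : ℝ)| ^ 2 := by nlinarith
      have h3 : 0 ≤ c * η * |(l : ℝ)| := by positivity
      nlinarith [mul_le_mul_of_nonneg_left h2 h3]
    have hκl0 := forcing_nonneg hb l
    have hκk0 := forcing_nonneg hb k
    have hx : 1 + (η / (l : ℝ) - t) ^ 2 < 4 * forcing (c * η) l ^ 2 := by
      unfold lorentz at h
      rw [← div_eq_mul_inv, lt_div_iff₀ (by positivity)] at h
      linarith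
    have hxl : |η / (l : ℝ) - t| ≤ 0.004 * D := by
      have h4 : |η / (l : ℝ) - t| ≤ 2 * forcing (c * η) l :=
        abs_le_of_sq_le_sq (by nlinarith) (by positivity)
      nlinarith
    have hxk : 0.9 * D ≤ |η / (k : ℝ) - t| := by
      have := abs_sub_le (η / (l : ℝ)) t (η / (k : ℝ))
      rw [hDabs, abs_sub_comm t] at this
      linarith
    have hwk : lorentz η k t ≤ 2 / D ^ 2 := by
      unfold lorentz
      rw [inv_eq_one_div, div_le_div_iff₀ (by positivity) (by positivity),
        ← sq_abs (η / (k : ℝ) - t)]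
      nlinarith
    have hamp : √(ampSq (c * η) η l t) ≤ 5 * forcing (c * η) l * resRate (c * η) η l t := by
      have h5 := resRate_mul_sqrt (c * η) η l t
      have h6 := sq_sqrt_ampSq (c * η) η l t
      have h7 := one_le_sqrt_ampSq (c * η) η l t
      have h8 : ampSq (c * η) η l t = 1 + forcing (c * η) l ^ 2 * lorentz η l t := rfl
      refine le_of_mul_le_mul_right ?_ (lt_of_lt_of_le one_pos h7)
      calc _ = √(ampSq (c * η) η l t) ^ 2 := (sq _).symm
        _ = ampSq (c * η) η l t := h6
        _ ≤ 5 * forcing (c * η) l * (forcing (c * η) l * lorentz η l t) := by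
            rw [h8]; nlinarith
        _ = _ := by rw [← h5]; ring
    have hprod : forcing (c * η) l * forcing (c * η) k ≤ c ^ 2 * D ^ 2 := by
      have : forcing (c * η) l * forcing (c * η) k = c ^ 2 * D ^ 2 / (|(l : ℝ)| * |(k : ℝ)|) := by
        unfold forcing
        rw [hD]
        field_simp
      rw [this]
      exact div_le_self (by positivity) (by nlinarith)
    have hfin : √(ampSq (c * η) η l t) * resRate (c * η) η k t
        ≤ 10 * c ^ 2 * resRate (c * η) η l t := by
      calc _ ≤ (5 * forcing (c * η) l * resRate (c * η) η l t)
              * (forcing (c * η) k * (2 / D ^ 2)) :=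
            mul_le_mul hamp ((resRate_le hb η k t).trans
              (mul_le_mul_of_nonneg_left hwk hκk0)) hrk (by positivity)
        _ = forcing (c * η) l * forcing (c * η) k * (10 / D ^ 2 * resRate (c * η) η l t) := by ring
        _ ≤ c ^ 2 * D ^ 2 * (10 / D ^ 2 * resRate (c * η) η l t) :=
            mul_le_mul_of_nonneg_right hprod (by positivity)
        _ = _ := by field_simp
    have : 10 * c ^ 2 ≤ 0.00001 := by nlinarith
    nlinarith [mul_le_mul_of_nonneg_right this hrl]

lemma lorentz_div_sq_le {η : ℝ} (hη : 0 < η) {l : ℤ} (hl : l ≠ 0) (t : ℝ) :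
    lorentz η l t / (l : ℝ) ^ 2 ≤ (1 + t ^ 2) / η ^ 2 := by
  have hl0 : (l : ℝ) ≠ 0 := by exact_mod_cast hl
  have e : lorentz η l t / (l : ℝ) ^ 2 = 1 / ((l : ℝ) ^ 2 + (η - l * t) ^ 2) := by
    unfold lorentz
    rw [div_eq_div_iff (by positivity) (by positivity)]
    field_simp
  rw [e, div_le_div_iff₀ (by positivity) (by positivity)]
  nlinarith [sq_nonneg ((l : ℝ) - t * (η - l * t))]

lemma abs_mul_sqrt_ampSq_mul_resRate_le {c η : ℝ} (hc : 0 < c) (hη : 0 < η)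
    {l k : ℤ} (hl : l ≠ 0) (hk : k ≠ 0) (hlk : |(l : ℝ) - k| = 1) (t : ℝ) :
    2 * |(l : ℝ)| / (1 + t ^ 2) * √(ampSq (c * η) η l t) * resRate (c * η) η k t
      ≤ 2 * c * resRate (c * η) η k t + 8 * (c * η) / (1 + t ^ 2 + η ^ 2) := by
  have hb : 0 ≤ c * η := by positivity
  have hrk := resRate_nonneg hb η k t
  have hL := one_le_abs_cast hl
  have hK := one_le_abs_cast hk
  have hLK : |(l : ℝ)| ≤ 2 * |(k : ℝ)| := by
    have := abs_sub_abs_le_abs_sub (l : ℝ) k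
    linarith
  have ht : 0 < 1 + t ^ 2 := by positivity
  have hsq : √(ampSq (c * η) η l t) ≤ 1 + c * (1 + t ^ 2) / |(l : ℝ)| := by
    refine Real.sqrt_le_iff.2 ⟨by positivity, ?_⟩
    have h1 : forcing (c * η) l ^ 2 * lorentz η l t ≤ (c * (1 + t ^ 2) / |(l : ℝ)|) ^ 2 := by
      have h2 := lorentz_div_sq_le hη hl t
      have e1 : forcing (c * η) l ^ 2 * lorentz η l t
          = (c * η) ^ 2 / |(l : ℝ)| ^ 4 * (lorentz η l t / (l : ℝ) ^ 2) := by
        unfold forcing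
        rw [← sq_abs (l : ℝ)]
        field_simp
      have h3 : (c * η) ^ 2 / |(l : ℝ)| ^ 4 * ((1 + t ^ 2) / η ^ 2)
          = c ^ 2 * (1 + t ^ 2) / |(l : ℝ)| ^ 4 := by
        field_simp
      rw [e1]
      refine (mul_le_mul_of_nonneg_left h2 (by positivity)).trans ?_
      rw [h3, div_pow, div_le_div_iff₀ (by positivity) (by positivity)]
      have h4 : (1 + t ^ 2) * |(l : ℝ)| ^ 2 ≤ (1 + t ^ 2) ^ 2 * |(l : ℝ)| ^ 4 := by
        refine mul_le_mul (by nlinarith [sq_nonneg t]) ?_ (by positivity) (by positivity)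
        exact pow_le_pow_right₀ hL (by norm_num)
      nlinarith [mul_le_mul_of_nonneg_left h4 (sq_nonneg c)]
    have h5 : 0 ≤ c * (1 + t ^ 2) / |(l : ℝ)| := by positivity
    unfold ampSq
    nlinarith
  have h6 : 2 * |(l : ℝ)| / (1 + t ^ 2) * √(ampSq (c * η) η l t)
      ≤ 2 * |(l : ℝ)| / (1 + t ^ 2) + 2 * c := by
    refine (mul_le_mul_of_nonneg_left hsq (by positivity)).trans (le_of_eq ?_)
    field_simp
  have h7 : 2 * |(l : ℝ)| / (1 + t ^ 2) * resRate (c * η) η k t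
      ≤ 8 * (c * η) / (1 + t ^ 2 + η ^ 2) := by
    have h8 : |(l : ℝ)| * (forcing (c * η) k * lorentz η k t)
        ≤ 2 * (c * η) * (lorentz η k t / (k : ℝ) ^ 2) := by
      have e : 2 * (c * η) * (lorentz η k t / (k : ℝ) ^ 2)
          = 2 * |(k : ℝ)| * (forcing (c * η) k * lorentz η k t) := by
        unfold forcing
        rw [← sq_abs (k : ℝ)]
        field_simp
      rw [e]
      exact mul_le_mul_of_nonneg_right hLK
        (mul_nonneg (forcing_nonneg hb k) (lorentz_pos η k t).le)
    have h9 := lorentz_div_sq_le hη hk t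
    have h10 : lorentz η k t / (k : ℝ) ^ 2 ≤ 1 := by
      refine div_le_one_of_le₀ ?_ (sq_nonneg _)
      rw [← sq_abs]
      nlinarith [lorentz_le_one η k t]
    have h11 : lorentz η k t / (k : ℝ) ^ 2 * (1 + t ^ 2 + η ^ 2) ≤ 2 * (1 + t ^ 2) := by
      rw [le_div_iff₀ (by positivity)] at h9
      nlinarith
    have h12 : |(l : ℝ)| * resRate (c * η) η k t
        ≤ 2 * (c * η) * (lorentz η k t / (k : ℝ) ^ 2) :=
      (mul_le_mul_of_nonneg_left (resRate_le hb η k t) (by positivity)).trans h8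
    rw [div_mul_eq_mul_div, div_le_div_iff₀ ht (by positivity)]
    calc _ = 2 * (|(l : ℝ)| * resRate (c * η) η k t) * (1 + t ^ 2 + η ^ 2) := by ring
      _ ≤ 2 * (2 * (c * η) * (lorentz η k t / (k : ℝ) ^ 2)) * (1 + t ^ 2 + η ^ 2) := by
          refine mul_le_mul_of_nonneg_right (by linarith) (by positivity)
      _ = 4 * (c * η) * (lorentz η k t / (k : ℝ) ^ 2 * (1 + t ^ 2 + η ^ 2)) := by ring
      _ ≤ 4 * (c * η) * (2 * (1 + t ^ 2)) := mul_le_mul_of_nonneg_left h11 (by positivity)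
      _ = _ := by ring
  have := mul_le_mul_of_nonneg_right h6 hrk
  nlinarith

lemma coupling_le {c η : ℝ} (hc : 0 < c) (hc' : c < 0.001) (hη : 0 < η)
    {l k : ℤ} (hl : l ≠ 0) (hk : k ≠ 0) (hlk : |(l : ℝ) - k| = 1) (t : ℝ) :
    4.4 * 2.24 * (2.24 + 2 * |(l : ℝ)| / (1 + t ^ 2)) *
        (√(ampSq (c * η) η l t) * resRate (c * η) η k t)
      ≤ 24.75 * resRate (c * η) η k t + 0.01 * resRate (c * η) η l t
        + 10 * (8 * (c * η) / (1 + t ^ 2 + η ^ 2)) := by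
  have hb : 0 ≤ c * η := by positivity
  have hrk := resRate_nonneg hb η k t
  have hrl := resRate_nonneg hb η l t
  have h1 := sqrt_ampSq_mul_resRate_le hc hc' hη hl hk hlk t
  have h2 := abs_mul_sqrt_ampSq_mul_resRate_le hc hη hl hk hlk t
  have h3 : 0 ≤ 8 * (c * η) / (1 + t ^ 2 + η ^ 2) := by positivity
  have h4 : c * resRate (c * η) η k t ≤ 0.001 * resRate (c * η) η k t :=
    mul_le_mul_of_nonneg_right hc'.le hrk
  nlinarith

/-- An explicitly integrable majorant of `resRate`. -/
def modeDens (b η : ℝ) (k : ℤ) (t : ℝ) : ℝ :=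
  if 0 < k then resDens (forcing b k) (t - η / (k : ℝ)) else forcing b k * lorentz η k t

/-- The primitive of `modeDens` vanishing at time zero. -/
def modePrim (b η : ℝ) (k : ℤ) (t : ℝ) : ℝ :=
  if 0 < k then resPrim (forcing b k) (t - η / (k : ℝ)) - resPrim (forcing b k) (0 - η / (k : ℝ))
  else forcing b k * (arctan (t - η / (k : ℝ)) - arctan (0 - η / (k : ℝ)))

lemma modePrim_zero (b η : ℝ) (k : ℤ) : modePrim b η k 0 = 0 := by
  unfold modePrim
  split_ifs <;> simp

lemma hasDerivAt_arctan_sub_div (η : ℝ) (k : ℤ) (t : ℝ) :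
    HasDerivAt (fun s => arctan (s - η / (k : ℝ))) (lorentz η k t) t := by
  have h := (((hasDerivAt_id t).sub_const (η / (k : ℝ))).arctan)
  refine h.congr_deriv ?_
  unfold lorentz
  simp only [id, mul_one, one_div]
  congr 2
  ring

lemma hasDerivAt_modePrim (b η : ℝ) (k : ℤ) (t : ℝ) :
    HasDerivAt (modePrim b η k) (modeDens b η k t) t := by
  unfold modeDens
  split_ifs with hk
  · have h := ((hasDerivAt_resPrim (forcing b k) (t - η / (k : ℝ))).comp t
      ((hasDerivAt_id t).sub_const (η / (k : ℝ)))).sub_const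
        (resPrim (forcing b k) (0 - η / (k : ℝ)))
    simp only [mul_one] at h
    refine h.congr_of_eventuallyEq (Filter.Eventually.of_forall fun s => ?_)
    simp [modePrim, hk]
  · have h := ((hasDerivAt_arctan_sub_div η k t).sub_const
      (arctan (0 - η / (k : ℝ)))).const_mul (forcing b k)
    refine h.congr_of_eventuallyEq (Filter.Eventually.of_forall fun s => ?_)
    simp [modePrim, hk]

lemma resRate_le_modeDens {b : ℝ} (hb : 0 ≤ b) (η : ℝ) (k : ℤ) (t : ℝ) :
    resRate b η k t ≤ modeDens b η k t := by
  unfold modeDens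
  split_ifs with hk
  · refine le_trans (le_of_eq ?_) (le_resDens (forcing_nonneg hb k) _)
    unfold resRate ampSq lorentz
    have e : (t - η / (k : ℝ)) ^ 2 = (η / (k : ℝ) - t) ^ 2 := by ring
    rw [e]
    have hX : 0 < 1 + (η / (k : ℝ) - t) ^ 2 := by positivity
    have e2 : 1 + forcing b k ^ 2 * (1 + (η / (k : ℝ) - t) ^ 2)⁻¹
        = (1 + forcing b k ^ 2 + (η / (k : ℝ) - t) ^ 2) / (1 + (η / (k : ℝ) - t) ^ 2) := by
      field_simp
      ring
    have hY : 0 < 1 + forcing b k ^ 2 + (η / (k : ℝ) - t) ^ 2 := by positivity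
    rw [e2, Real.sqrt_div hY.le]
    have h1 := Real.mul_self_sqrt hX.le
    have h2 := Real.sqrt_pos.2 hX
    have h3 := Real.sqrt_pos.2 hY
    nth_rewrite 1 [← h1]
    field_simp
  · exact resRate_le hb η k t

lemma modeDens_nonneg {b : ℝ} (hb : 0 ≤ b) (η : ℝ) (k : ℤ) (t : ℝ) : 0 ≤ modeDens b η k t :=
  (resRate_nonneg hb η k t).trans (resRate_le_modeDens hb η k t)

lemma modeDens_le {b : ℝ} (hb : 0 ≤ b) (η : ℝ) (k : ℤ) (t : ℝ) :
    modeDens b η k t ≤ 2 * forcing b k := by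
  have h0 := forcing_nonneg hb k
  unfold modeDens
  split_ifs
  · exact resDens_le h0 _
  · nlinarith [lorentz_le_one η k t]

lemma summable_forcing (b : ℝ) : Summable (forcing b) := by
  have h : Summable fun k : ℤ => |1 / (k : ℝ) ^ 3| :=
    summable_abs_iff.2 (Real.summable_one_div_int_pow.2 (by norm_num))
  refine (h.mul_left b).congr fun k => ?_
  rw [abs_div, abs_pow, abs_one, forcing]
  ring

lemma summable_modeDens {b : ℝ} (hb : 0 ≤ b) (η t : ℝ) : Summable fun k => modeDens b η k t :=
  Summable.of_nonneg_of_le (fun k => modeDens_nonneg hb η k t) (fun k => modeDens_le hb η k t)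
    ((summable_forcing b).mul_left 2)

lemma hasDerivAt_tsum_modePrim {b : ℝ} (hb : 0 ≤ b) (η t : ℝ) :
    HasDerivAt (fun s => ∑' k, modePrim b η k s) (∑' k, modeDens b η k t) t :=
  hasDerivAt_tsum (u := fun k => 2 * forcing b k) ((summable_forcing b).mul_left 2)
    (fun k s => hasDerivAt_modePrim b η k s)
    (fun k s => by
      rw [Real.norm_of_nonneg (modeDens_nonneg hb η k s)]
      exact modeDens_le hb η k s)
    (y₀ := 0) (by simpa only [modePrim_zero] using summable_zero) t

lemma summable_modePrim {b : ℝ} (hb : 0 ≤ b) (η t : ℝ) : Summable fun k => modePrim b η k t :=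
  summable_of_summable_hasDerivAt (u := fun k => 2 * forcing b k)
    ((summable_forcing b).mul_left 2)
    (fun k s => hasDerivAt_modePrim b η k s)
    (fun k s => by
      rw [Real.norm_of_nonneg (modeDens_nonneg hb η k s)]
      exact modeDens_le hb η k s)
    (y₀ := 0) (by simpa only [modePrim_zero] using summable_zero) t

lemma modePrim_nonneg {b : ℝ} (hb : 0 ≤ b) (η : ℝ) (k : ℤ) {t : ℝ} (ht : 0 ≤ t) :
    0 ≤ modePrim b η k t := by
  have hmono : Monotone (modePrim b η k) :=
    monotone_of_deriv_nonneg (fun s => (hasDerivAt_modePrim b η k s).differentiableAt)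
      (fun s => by rw [(hasDerivAt_modePrim b η k s).deriv]; exact modeDens_nonneg hb η k s)
  exact modePrim_zero b η k ▸ hmono ht

lemma modePrim_neg_le {c η : ℝ} (hc : 0 < c) (hη : 0 < η) (n : ℕ) (t : ℝ) :
    modePrim (c * η) η (-((n : ℤ) + 1)) t ≤ c * (1 / ((n : ℝ) + 1) ^ 2) := by
  have hk : ¬ (0 < -((n : ℤ) + 1)) := by omega
  have hn : (0 : ℝ) < n + 1 := by positivity
  unfold modePrim forcing
  rw [if_neg hk]
  push_cast
  have hy : 0 - η / (-((n : ℝ) + 1)) = η / (n + 1) := by rw [div_neg]; ring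
  rw [hy, abs_neg, abs_of_pos hn]
  refine (mul_le_mul_of_nonneg_left (arctan_sub_arctan_le (div_pos hη hn))
    (by positivity)).trans (le_of_eq ?_)
  field_simp

lemma sum_range_inv_sq_le (n : ℕ) : ∑ k ∈ Finset.range n, 1 / ((k : ℝ) + 1) ^ 2 ≤ 2 := by
  have h : ∑ k ∈ Finset.range n, 1 / ((k : ℝ) + 1) ^ 2 ≤ 2 - 1 / ((n : ℝ) + 1 / 2) := by
    induction n with
    | zero => norm_num
    | succ n ih =>
      rw [Finset.sum_range_succ]
      have : 1 / ((n : ℝ) + 1) ^ 2 ≤ 1 / ((n : ℝ) + 1 / 2) - 1 / ((n : ℝ) + 1 + 1 / 2) := by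
        rw [div_sub_div _ _ (by positivity) (by positivity),
          div_le_div_iff₀ (by positivity) (by positivity)]
        nlinarith
      push_cast
      linarith
  have : 0 ≤ 1 / ((n : ℝ) + 1 / 2) := by positivity
  linarith

lemma modePrim_succ_le {b B : ℝ} (hb : 0 ≤ b) (η : ℝ) (hBc : B ^ 3 = b) (n : ℕ) (t : ℝ) :
    modePrim b η ((n + 1 : ℕ) : ℤ) t
      ≤ (B ^ 3 / ((n : ℝ) + 1) ^ 3) / √(1 + (B ^ 3 / ((n : ℝ) + 1) ^ 3) ^ 2)
        * (log (1 + (B ^ 3 / ((n : ℝ) + 1) ^ 3) ^ 2) + π) := by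
  have hf : forcing b ((n + 1 : ℕ) : ℤ) = B ^ 3 / ((n : ℝ) + 1) ^ 3 := by
    unfold forcing
    push_cast
    rw [abs_of_pos (by positivity), hBc]
  have hn : (0 : ℤ) < ((n + 1 : ℕ) : ℤ) := by positivity
  rw [← hf]
  simp only [modePrim, if_pos hn]
  exact resPrim_sub_le (forcing_nonneg hb _) _ _

lemma sum_range_modePrim_le {b B : ℝ} (hb : 0 ≤ b) (η : ℝ) (hB : 0 < B) (hBc : B ^ 3 = b)
    {t : ℝ} (ht : 0 ≤ t) (n : ℕ) :
    ∑ k ∈ Finset.range n, modePrim b η (k : ℤ) t ≤ 19 * B := by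
  have h3 : ∑ k ∈ Finset.range n, modePrim b η (k : ℤ) t
      ≤ ∑ k ∈ Finset.range (n + 1), modePrim b η (k : ℤ) t := by
    rw [Finset.sum_range_succ]
    linarith [modePrim_nonneg hb η (n : ℤ) ht]
  rw [Finset.sum_range_succ'] at h3
  have h4 : modePrim b η ((0 : ℕ) : ℤ) t = 0 := by
    simp [modePrim, forcing]
  rw [h4, add_zero] at h3
  exact h3.trans ((Finset.sum_le_sum fun k _ => modePrim_succ_le hb η hBc k t).trans
    (sum_range_resTotal_le hB n))

lemma sum_range_modePrim_neg_le {c η : ℝ} (hc : 0 < c) (hη : 0 < η) (t : ℝ) (n : ℕ) :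
    ∑ k ∈ Finset.range n, modePrim (c * η) η (-((k : ℤ) + 1)) t ≤ 2 * c := by
  refine (Finset.sum_le_sum fun k _ => modePrim_neg_le hc hη k t).trans ?_
  rw [← Finset.mul_sum]
  nlinarith [sum_range_inv_sq_le n]

/-- The total resonant growth is of order `(cη)^{1/3}`. -/
lemma tsum_modePrim_le {c η B : ℝ} (hc : 0 < c) (hη : 0 < η) (hB : 0 < B)
    (hBc : B ^ 3 = c * η) {t : ℝ} (ht : 0 ≤ t) :
    ∑' k, modePrim (c * η) η k t ≤ 19 * B + 2 * c := by
  have hb : 0 ≤ c * η := by positivity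
  have hs := summable_modePrim hb η t
  have h1 : Summable fun n : ℕ => modePrim (c * η) η (n : ℤ) t :=
    hs.comp_injective Nat.cast_injective
  have h2 : Summable fun n : ℕ => modePrim (c * η) η (-((n : ℤ) + 1)) t :=
    hs.comp_injective (i := fun n : ℕ => -((n : ℤ) + 1)) fun a b h => by
      simp only at h; omega
  rw [tsum_of_nat_of_neg_add_one (f := fun k => modePrim (c * η) η k t) h1 h2]
  exact add_le_add
    (Real.tsum_le_of_sum_range_le (fun n => modePrim_nonneg hb η _ ht)
      (sum_range_modePrim_le hb η hB hBc ht))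
    (Real.tsum_le_of_sum_range_le (fun n => modePrim_nonneg hb η _ ht)
      (sum_range_modePrim_neg_le hc hη t))

/-- The size of a mode pair, with the second component discounted. -/
def modeSize (x y : ℂ) : ℝ := √(‖x‖ ^ 2 + ‖y‖ ^ 2 / 4)

/-- The amplitude weight of mode `l`. -/
def modeAmp (lam : ℤ → ℝ) (b η : ℝ) (l : ℤ) (t : ℝ) : ℝ :=
  lam l * rexp (-arctan (t - η / (l : ℝ)) / 4) * √(ampSq b η l t)

/-- The weighted size of mode `l`. -/
def weightedSize (lam : ℤ → ℝ) (b η : ℝ) (θ G : ℝ → ℤ → ℂ) (t : ℝ) (l : ℤ) : ℝ :=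
  modeAmp lam b η l t * modeSize (θ t l) (G t l)

lemma modeSize_sq (x y : ℂ) : modeSize x y ^ 2 = ‖x‖ ^ 2 + ‖y‖ ^ 2 / 4 :=
  Real.sq_sqrt (by positivity)

lemma modeSize_nonneg (x y : ℂ) : 0 ≤ modeSize x y := Real.sqrt_nonneg _

lemma norm_add_norm_le_modeSize (x y : ℂ) : ‖x‖ + ‖y‖ ≤ 2.24 * modeSize x y := by
  have h := modeSize_nonneg x y
  refine abs_le_of_sq_le_sq' ?_ (by positivity) |>.2
  rw [mul_pow, modeSize_sq]
  nlinarith [sq_nonneg (4 * ‖x‖ - ‖y‖), sq_nonneg ‖x‖, sq_nonneg ‖y‖]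

lemma two_mul_norm_add_le_modeSize (x y : ℂ) {h : ℝ} (hh : 0 ≤ h) :
    2 * ‖x‖ + (1 + h) * ‖y‖ / 2 ≤ (2.24 + h) * modeSize x y := by
  have h0 := modeSize_nonneg x y
  have h1 : 2 * ‖x‖ + ‖y‖ / 2 ≤ 2.24 * modeSize x y := by
    refine abs_le_of_sq_le_sq' ?_ (by positivity) |>.2
    rw [mul_pow, modeSize_sq]
    nlinarith [sq_nonneg (‖x‖ - ‖y‖), sq_nonneg ‖x‖, sq_nonneg ‖y‖]
  have h2 : ‖y‖ / 2 ≤ modeSize x y := by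
    refine abs_le_of_sq_le_sq' ?_ (by positivity) |>.2
    rw [modeSize_sq]
    nlinarith [sq_nonneg ‖x‖]
  nlinarith [mul_le_mul_of_nonneg_left h2 hh]

lemma modeAmp_sq (lam : ℤ → ℝ) (b η : ℝ) (l : ℤ) (t : ℝ) :
    modeAmp lam b η l t ^ 2
      = lam l ^ 2 * (rexp (-arctan (t - η / (l : ℝ)) / 2) * ampSq b η l t) := by
  unfold modeAmp
  have e : rexp (-arctan (t - η / (l : ℝ)) / 2) = rexp (-arctan (t - η / (l : ℝ)) / 4) ^ 2 := by
    rw [← Real.exp_nat_mul]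
    push_cast
    ring_nf
  rw [mul_pow, mul_pow, sq_sqrt_ampSq, e, mul_assoc]

lemma exp_pi_div_four_le : rexp (π / 4) ≤ 2.2 := by
  have h1 : π / 4 ≤ 11 / 14 := by linarith [Real.pi_lt_d4]
  refine (Real.exp_le_exp.2 h1).trans ?_
  refine le_of_pow_le_pow_left₀ (n := 14) (by norm_num) (by norm_num) ?_
  rw [← Real.exp_nat_mul]
  have h2 : rexp ((14 : ℕ) * (11 / 14)) = rexp 1 ^ 11 := by
    rw [← Real.exp_nat_mul]
    norm_num
  rw [h2]
  exact (pow_le_pow_left₀ (Real.exp_pos _).le Real.exp_one_lt_d9.le 11).trans (by norm_num)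

lemma modeAmp_nonneg {lam : ℤ → ℝ} (hlam : ∀ l, 0 < lam l) (b η : ℝ) (l : ℤ) (t : ℝ) :
    0 ≤ modeAmp lam b η l t := by
  have := hlam l
  unfold modeAmp
  positivity

lemma weightedSize_nonneg {lam : ℤ → ℝ} (hlam : ∀ l, 0 < lam l) (b η : ℝ)
    (θ G : ℝ → ℤ → ℂ) (t : ℝ) (l : ℤ) : 0 ≤ weightedSize lam b η θ G t l :=
  mul_nonneg (modeAmp_nonneg hlam b η l t) (modeSize_nonneg _ _)

lemma modeAmp_mul_sqrt_le {lam : ℤ → ℝ} (hlam : ∀ l, 0 < lam l) (b η : ℝ) {l k : ℤ}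
    (hlk : lam l ≤ 2 * lam k) (t : ℝ) :
    modeAmp lam b η l t * √(ampSq b η k t)
      ≤ 4.4 * (√(ampSq b η l t) * modeAmp lam b η k t) := by
  have h1 : rexp (-arctan (t - η / (l : ℝ)) / 4)
      ≤ 2.2 * rexp (-arctan (t - η / (k : ℝ)) / 4) := by
    refine le_trans ?_ (mul_le_mul_of_nonneg_right exp_pi_div_four_le (Real.exp_pos _).le)
    rw [← Real.exp_add, Real.exp_le_exp]
    linarith [Real.neg_pi_div_two_lt_arctan (t - η / (l : ℝ)),
      Real.arctan_lt_pi_div_two (t - η / (k : ℝ))]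
  have h2 : lam l * rexp (-arctan (t - η / (l : ℝ)) / 4)
      ≤ 2 * lam k * (2.2 * rexp (-arctan (t - η / (k : ℝ)) / 4)) :=
    mul_le_mul hlk h1 (Real.exp_pos _).le (by linarith [hlam k])
  have h3 : 0 ≤ √(ampSq b η l t) * √(ampSq b η k t) := by positivity
  have h4 := mul_le_mul_of_nonneg_right h2 h3
  unfold modeAmp
  nlinarith

lemma hasDerivAt_lorentz (η : ℝ) (k : ℤ) (t : ℝ) :
    HasDerivAt (lorentz η k) (2 * (η / (k : ℝ) - t) * lorentz η k t ^ 2) t := by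
  have h := ((((hasDerivAt_id t).const_sub (η / (k : ℝ))).pow 2).const_add 1).inv
    (by simp only [id, Pi.pow_apply]; positivity)
  refine h.congr_deriv ?_
  simp only [lorentz, id, Pi.pow_apply, inv_pow]
  field_simp
  norm_num [mul_comm]

lemma abs_two_mul_lorentz_sq_le (η : ℝ) (k : ℤ) (t : ℝ) :
    |2 * (η / (k : ℝ) - t) * lorentz η k t ^ 2| ≤ lorentz η k t := by
  have hw := lorentz_pos η k t
  have hx : (1 + (η / (k : ℝ) - t) ^ 2) * lorentz η k t = 1 := by
    unfold lorentz
    exact mul_inv_cancel₀ (by positivity)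
  rw [abs_mul, abs_of_pos (pow_pos hw 2), abs_mul, abs_two]
  have h1 : 2 * |η / (k : ℝ) - t| ≤ 1 + (η / (k : ℝ) - t) ^ 2 := by
    rw [← sq_abs (η / (k : ℝ) - t)]
    nlinarith [sq_nonneg (|η / (k : ℝ) - t| - 1)]
  nlinarith [mul_le_mul_of_nonneg_right h1 (sq_nonneg (lorentz η k t))]

lemma forcing_sq_mul_le {b : ℝ} (hb : 0 ≤ b) (η : ℝ) (k : ℤ) (t : ℝ) :
    forcing b k ^ 2 * (2 * (η / (k : ℝ) - t) * lorentz η k t ^ 2)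
      ≤ 2 * resRate b η k t * ampSq b η k t := by
  have hw := lorentz_pos η k t
  have hκ := forcing_nonneg hb k
  have hx : (η / (k : ℝ) - t) ^ 2 * lorentz η k t ≤ 1 := by
    have : (1 + (η / (k : ℝ) - t) ^ 2) * lorentz η k t = 1 := by
      unfold lorentz
      exact mul_inv_cancel₀ (by positivity)
    nlinarith
  have h1 : forcing b k * |η / (k : ℝ) - t| * lorentz η k t ≤ √(ampSq b η k t) := by
    refine Real.le_sqrt_of_sq_le ?_
    have e : (forcing b k * |η / (k : ℝ) - t| * lorentz η k t) ^ 2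
        = forcing b k ^ 2 * lorentz η k t * ((η / (k : ℝ) - t) ^ 2 * lorentz η k t) := by
      rw [mul_pow, mul_pow, sq_abs]; ring
    rw [e]
    unfold ampSq
    have : 0 ≤ forcing b k ^ 2 * lorentz η k t := by positivity
    nlinarith
  have h2 : 0 ≤ forcing b k * lorentz η k t := by positivity
  calc _ ≤ 2 * (forcing b k * lorentz η k t)
        * (forcing b k * |η / (k : ℝ) - t| * lorentz η k t) := by
        have h3 := mul_le_mul_of_nonneg_left (le_abs_self (η / (k : ℝ) - t))
          (by positivity : 0 ≤ forcing b k ^ 2 * lorentz η k t ^ 2)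
        nlinarith
    _ ≤ 2 * (forcing b k * lorentz η k t) * √(ampSq b η k t) :=
        mul_le_mul_of_nonneg_left h1 (by positivity)
    _ = 2 * resRate b η k t * √(ampSq b η k t) ^ 2 := by
        rw [← resRate_mul_sqrt]; ring
    _ = _ := by rw [sq_sqrt_ampSq]

lemma exists_hasDerivAt_modeAmp_sq {b : ℝ} (hb : 0 ≤ b) (lam : ℤ → ℝ) (η : ℝ) (l : ℤ) (t : ℝ) :
    ∃ q, HasDerivAt (fun s => modeAmp lam b η l s ^ 2) q t ∧
      q ≤ (2 * resRate b η l t - lorentz η l t / 2) * modeAmp lam b η l t ^ 2 := by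
  simp only [modeAmp_sq]
  have h1 := ((hasDerivAt_arctan_sub_div η l t).neg.div_const 2).exp
  have h2 := ((hasDerivAt_lorentz η l t).const_mul (forcing b l ^ 2)).const_add 1
  refine ⟨_, (h1.mul h2).const_mul (lam l ^ 2), ?_⟩
  have h3 := forcing_sq_mul_le hb η l t
  have h4 : 0 ≤ lam l ^ 2 * rexp (-arctan (t - η / (l : ℝ)) / 2) := by positivity
  have h5 := mul_le_mul_of_nonneg_left h3 h4
  have h6 : ampSq b η l t = 1 + forcing b l ^ 2 * lorentz η l t := rfl
  simp only [Pi.neg_apply]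
  rw [h6] at h5 ⊢
  linarith

/-- The energy identity for a single mode, with the neighbouring modes collected in `S`. -/
lemma inner_mode_le {x y S z : ℂ} {p v w h : ℝ} (hp : 0 ≤ p) (hv : |v| ≤ w) (hz : ‖z‖ ≤ 1 + h) :
    2 * inner ℝ x S + 2 * inner ℝ y (-(p : ℂ) * y + z * S + (v : ℂ) * x) / 4
      ≤ (2 * ‖x‖ + (1 + h) * ‖y‖ / 2) * ‖S‖ + w / 2 * modeSize x y ^ 2 := by
  have h1 := real_inner_le_norm x S
  have h2 : inner ℝ y (-(p : ℂ) * y) ≤ 0 := by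
    rw [← Complex.ofReal_neg, ← Complex.real_smul, real_inner_smul_right,
      real_inner_self_eq_norm_sq]
    nlinarith [mul_nonneg hp (sq_nonneg ‖y‖)]
  have h3 : inner ℝ y (z * S) ≤ (1 + h) * ‖y‖ * ‖S‖ := by
    refine (real_inner_le_norm y (z * S)).trans ?_
    rw [norm_mul]
    nlinarith [mul_le_mul_of_nonneg_right hz (mul_nonneg (norm_nonneg y) (norm_nonneg S))]
  have h4 : inner ℝ y ((v : ℂ) * x) ≤ w * (‖x‖ * ‖y‖) := by
    refine (real_inner_le_norm y _).trans ?_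
    rw [norm_mul, Complex.norm_real, Real.norm_eq_abs]
    nlinarith [mul_le_mul_of_nonneg_right hv (mul_nonneg (norm_nonneg x) (norm_nonneg y))]
  have hw : 0 ≤ w := (abs_nonneg v).trans hv
  have h5 : ‖x‖ * ‖y‖ ≤ modeSize x y ^ 2 := by
    rw [modeSize_sq]
    nlinarith [sq_nonneg (‖x‖ - ‖y‖ / 2)]
  rw [inner_add_right, inner_add_right]
  nlinarith [mul_le_mul_of_nonneg_left h5 hw]

lemma forcing_mul_lorentz_eq (c η : ℝ) (hb : 0 ≤ c * η) (k : ℤ) (t : ℝ) :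
    |c * η / (k : ℝ) ^ 3 * (1 + (η / (k : ℝ) - t) ^ 2)⁻¹|
      = forcing (c * η) k * lorentz η k t := by
  rw [abs_mul, abs_div, abs_pow, abs_of_nonneg hb,
    abs_of_pos (inv_pos.2 (by positivity : 0 < 1 + (η / (k : ℝ) - t) ^ 2))]
  rfl

lemma forcing_mul_lorentz_sq_le (c η : ℝ) (hb : 0 ≤ c * η) (k : ℤ) (t : ℝ) :
    |c * η / (k : ℝ) ^ 3 * ((1 + (η / (k : ℝ) - t) ^ 2) ^ 2)⁻¹|
      ≤ forcing (c * η) k * lorentz η k t := by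
  have h := forcing_mul_lorentz_eq c η hb k t
  have hw := lorentz_pos η k t
  have e : ((1 + (η / (k : ℝ) - t) ^ 2) ^ 2)⁻¹
      = (1 + (η / (k : ℝ) - t) ^ 2)⁻¹ * lorentz η k t := by
    rw [← inv_pow, sq]; rfl
  rw [e, ← mul_assoc, abs_mul, h, abs_of_pos hw]
  exact mul_le_of_le_one_right (mul_nonneg (forcing_nonneg hb k) hw.le) (lorentz_le_one η k t)

lemma abs_coeff_le {c η : ℝ} (hb : 0 ≤ c * η) (l : ℤ) (t : ℝ) :
    (|cP c η l t| ≤ forcing (c * η) (l + 1) * lorentz η (l + 1) t ∧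
      |dP c η l t| ≤ forcing (c * η) (l + 1) * lorentz η (l + 1) t) ∧
    (|cM c η l t| ≤ forcing (c * η) (l - 1) * lorentz η (l - 1) t ∧
      |dM c η l t| ≤ forcing (c * η) (l - 1) * lorentz η (l - 1) t) := by
  have h (k : ℤ) : 0 ≤ forcing (c * η) k * lorentz η k t :=
    mul_nonneg (forcing_nonneg hb k) (lorentz_pos η k t).le
  have h1 := forcing_mul_lorentz_eq c η hb (l + 1) t
  have h2 := forcing_mul_lorentz_eq c η hb (l - 1) t
  have h3 := forcing_mul_lorentz_sq_le c η hb (l + 1) t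
  have h4 := forcing_mul_lorentz_sq_le c η hb (l - 1) t
  push_cast at h1 h2 h3 h4
  unfold cP dP cM dM
  refine ⟨⟨?_, ?_⟩, ?_, ?_⟩ <;> split_ifs
  any_goals simpa using h _
  exacts [h3, h1.le, h4, h2.le]

lemma norm_thetaRHS_le {c η : ℝ} (hb : 0 ≤ c * η) (θ G : ℝ → ℤ → ℂ) (l : ℤ) (t : ℝ) :
    ‖thetaRHS c η θ G l t‖
      ≤ forcing (c * η) (l + 1) * lorentz η (l + 1) t * (‖θ t (l + 1)‖ + ‖G t (l + 1)‖)
        + forcing (c * η) (l - 1) * lorentz η (l - 1) t * (‖θ t (l - 1)‖ + ‖G t (l - 1)‖) := by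
  obtain ⟨⟨h1, h2⟩, h3, h4⟩ := abs_coeff_le hb l t
  have key (a : ℝ) (x : ℂ) {u : ℝ} (h : |a| ≤ u) : ‖(a : ℂ) * x‖ ≤ u * ‖x‖ := by
    rw [norm_mul, Complex.norm_real]
    exact mul_le_mul_of_nonneg_right h (norm_nonneg x)
  unfold thetaRHS
  refine (norm_add_le _ _).trans ((add_le_add_left (norm_add_le _ _) _).trans
    ((add_le_add_left (add_le_add_left (norm_add_le _ _) _) _).trans ?_))
  linarith [key _ (θ t (l + 1)) h1, key _ (θ t (l - 1)) h3, key _ (G t (l + 1)) h2,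
    key _ (G t (l - 1)) h4]

lemma neighbour_le {c η : ℝ} (hc : 0 < c) (hc' : c < 0.001) (hη : 0 < η) {lam : ℤ → ℝ}
    (hlam : ∀ l, 0 < lam l) (θ G : ℝ → ℤ → ℂ) {l k : ℤ} (hl : l ≠ 0)
    (hlk : |(l : ℝ) - k| = 1) (hlamk : lam l ≤ 2 * lam k) (t : ℝ) :
    modeAmp lam (c * η) η l t ^ 2
        * ((2.24 + 2 * |(l : ℝ)| / (1 + t ^ 2)) * modeSize (θ t l) (G t l))
        * (forcing (c * η) k * lorentz η k t * (‖θ t k‖ + ‖G t k‖))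
      ≤ (24.75 * resRate (c * η) η k t + 0.01 * resRate (c * η) η l t
          + 10 * (8 * (c * η) / (1 + t ^ 2 + η ^ 2)))
        * (weightedSize lam (c * η) η θ G t l * weightedSize lam (c * η) η θ G t k) := by
  have hb : 0 ≤ c * η := by positivity
  have hel := weightedSize_nonneg hlam (c * η) η θ G t l
  have hek := weightedSize_nonneg hlam (c * η) η θ G t k
  have hrk := resRate_nonneg hb η k t
  have hrl := resRate_nonneg hb η l t
  rcases eq_or_ne k 0 with rfl | hk
  · have h0 : forcing (c * η) 0 = 0 := by simp [forcing]
    rw [h0]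
    simp only [zero_mul, mul_zero]
    positivity
  · have h1 := coupling_le hc hc' hη hl hk hlk t
    have h2 := modeAmp_mul_sqrt_le hlam (c * η) η hlamk t
    have h3 := norm_add_norm_le_modeSize (θ t k) (G t k)
    have hA := modeAmp_nonneg hlam (c * η) η l t
    have hN := modeSize_nonneg (θ t l) (G t l)
    have hNk := modeSize_nonneg (θ t k) (G t k)
    have hU : 0 ≤ 2.24 + 2 * |(l : ℝ)| / (1 + t ^ 2) := by positivity
    refine le_trans ?_ (mul_le_mul_of_nonneg_right h1 (mul_nonneg hel hek))
    rw [← resRate_mul_sqrt]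
    set U := 2.24 + 2 * |(l : ℝ)| / (1 + t ^ 2)
    unfold weightedSize
    set A := modeAmp lam (c * η) η l t
    set A' := modeAmp lam (c * η) η k t
    set N := modeSize (θ t l) (G t l)
    set N' := modeSize (θ t k) (G t k)
    set r := resRate (c * η) η k t
    set s := √(ampSq (c * η) η k t)
    set s' := √(ampSq (c * η) η l t)
    calc A ^ 2 * (U * N) * (r * s * (‖θ t k‖ + ‖G t k‖))
        ≤ A ^ 2 * (U * N) * (r * s * (2.24 * N')) := by
          have : 0 ≤ s := Real.sqrt_nonneg _
          gcongr
      _ = (A * s) * (2.24 * U * N * r * A * N') := by ring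
      _ ≤ (4.4 * (s' * A')) * (2.24 * U * N * r * A * N') :=
          mul_le_mul_of_nonneg_right h2 (by positivity)
      _ = _ := by ring

lemma exists_hasDerivAt_weightedSize_sq {ν c η : ℝ} (hν : 0 < ν) (hc : 0 < c) (hc' : c < 0.001)
    (hη : 0 < η) {f : ℝ → ℝ} (hfb : ∀ t : ℝ, 0 ≤ t → |f t| ≤ 4 * c / (1 + t ^ 2))
    {θ G : ℝ → ℤ → ℂ} (hsol : IsWaveSol ν c η f θ G) {lam : ℤ → ℝ} (hlam : GoodWeight lam)
    {l : ℤ} (hl : l ≠ 0) (t : ℝ) :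
    ∃ D, HasDerivAt (fun s => weightedSize lam (c * η) η θ G s l ^ 2) D t ∧ (0 ≤ t →
      D ≤ 2 * resRate (c * η) η l t * weightedSize lam (c * η) η θ G t l ^ 2
        + (24.75 * resRate (c * η) η (l + 1) t + 0.01 * resRate (c * η) η l t
          + 10 * (8 * (c * η) / (1 + t ^ 2 + η ^ 2)))
          * (weightedSize lam (c * η) η θ G t l * weightedSize lam (c * η) η θ G t (l + 1))
        + (24.75 * resRate (c * η) η (l - 1) t + 0.01 * resRate (c * η) η l t
          + 10 * (8 * (c * η) / (1 + t ^ 2 + η ^ 2)))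
          * (weightedSize lam (c * η) η θ G t l * weightedSize lam (c * η) η θ G t (l - 1))) := by
  have hb : 0 ≤ c * η := by positivity
  obtain ⟨q, hq, hqle⟩ := exists_hasDerivAt_modeAmp_sq hb lam η l t
  obtain ⟨hθ, hG⟩ := hsol.2.2 l hl t
  have e : (fun s => weightedSize lam (c * η) η θ G s l ^ 2)
      = fun s => modeAmp lam (c * η) η l s ^ 2 * (‖θ s l‖ ^ 2 + ‖G s l‖ ^ 2 / 4) := by
    ext s
    rw [weightedSize, mul_pow, modeSize_sq]
  rw [e]
  refine ⟨_, hq.mul (hθ.norm_sq.add (hG.norm_sq.div_const 4)), fun ht => ?_⟩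
  set S := thetaRHS c η θ G l t with hS
  set z : ℂ := (lorentz η l t : ℂ) + (f t : ℂ) * (Complex.I * (l : ℂ) / ((2 * c : ℝ) : ℂ)) with hz
  set h : ℝ := 2 * |(l : ℝ)| / (1 + t ^ 2) with hh
  have hh0 : 0 ≤ h := by positivity
  have hGe : GRHS ν c η f θ G l t
      = -((ν * ((l : ℝ) ^ 2 + (η - (l : ℝ) * t) ^ 2) : ℝ) : ℂ) * G t l + z * S
        + ((2 * (η / (l : ℝ) - t) * lorentz η l t ^ 2 : ℝ) : ℂ) * θ t l := by
    have e2 : lorentz η l t ^ 2 = ((1 + (η / (l : ℝ) - t) ^ 2) ^ 2)⁻¹ := by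
      rw [← inv_pow]; rfl
    rw [e2, hz, hS]
    unfold GRHS thetaRHS lorentz
    ring
  have hzn : ‖z‖ ≤ 1 + h := by
    refine (norm_add_le _ _).trans (add_le_add ?_ ?_)
    · rw [Complex.norm_real, Real.norm_of_nonneg (lorentz_pos η l t).le]
      exact lorentz_le_one η l t
    · rw [norm_mul, norm_div, norm_mul, Complex.norm_real, Complex.norm_real, Complex.norm_I,
        Complex.norm_intCast, Real.norm_eq_abs, Real.norm_of_nonneg (by positivity : 0 ≤ 2 * c)]
      refine (mul_le_mul_of_nonneg_right (hfb t ht) (by positivity)).trans (le_of_eq ?_)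
      rw [hh]
      field_simp
      ring
  have hI := inner_mode_le (x := θ t l) (y := G t l) (S := S)
    (by positivity : 0 ≤ ν * ((l : ℝ) ^ 2 + (η - (l : ℝ) * t) ^ 2))
    (abs_two_mul_lorentz_sq_le η l t) hzn
  rw [← hGe] at hI
  have hSn := norm_thetaRHS_le hb θ G l t
  rw [← hS] at hSn
  have hN := two_mul_norm_add_le_modeSize (θ t l) (G t l) hh0
  have h1 := neighbour_le hc hc' hη hlam.1 θ G (k := l + 1) hl (by push_cast; norm_num)
    (by have := hlam.2.2 (l + 1); rw [add_sub_cancel_right] at this; exact this.le) t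
  have h2 := neighbour_le hc hc' hη hlam.1 θ G (k := l - 1) hl (by push_cast; norm_num)
    (by have := hlam.2.1 (l - 1); rw [sub_add_cancel] at this; exact this.le) t
  rw [← hh] at h1 h2
  have hA : 0 ≤ modeAmp lam (c * η) η l t ^ 2 := sq_nonneg _
  have hM : 0 ≤ modeSize (θ t l) (G t l) := modeSize_nonneg _ _
  have h3 : modeAmp lam (c * η) η l t ^ 2 * ((2 * ‖θ t l‖ + (1 + h) * ‖G t l‖ / 2) * ‖S‖)
      ≤ modeAmp lam (c * η) η l t ^ 2 * ((2.24 + h) * modeSize (θ t l) (G t l)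
        * (forcing (c * η) (l + 1) * lorentz η (l + 1) t * (‖θ t (l + 1)‖ + ‖G t (l + 1)‖)
        + forcing (c * η) (l - 1) * lorentz η (l - 1) t * (‖θ t (l - 1)‖ + ‖G t (l - 1)‖))) :=
    mul_le_mul_of_nonneg_left (mul_le_mul hN hSn (norm_nonneg _) (by positivity)) hA
  have h4 := mul_le_mul_of_nonneg_left hI hA
  have h5 := mul_le_mul_of_nonneg_right hqle (sq_nonneg (modeSize (θ t l) (G t l)))
  have e3 : weightedSize lam (c * η) η θ G t l ^ 2
      = modeAmp lam (c * η) η l t ^ 2 * modeSize (θ t l) (G t l) ^ 2 := mul_pow _ _ _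
  simp only [← modeSize_sq]
  rw [e3]
  linarith

lemma forcing_le {b : ℝ} (hb : 0 ≤ b) (k : ℤ) : forcing b k ≤ b := by
  unfold forcing
  rcases eq_or_ne k 0 with rfl | hk
  · simpa using hb
  · exact div_le_self hb (one_le_pow₀ (one_le_abs_cast hk))

lemma exp_neg_arctan_le (x : ℝ) : rexp (-arctan x / 2) ≤ 2.2 :=
  (Real.exp_le_exp.2 (by linarith [Real.neg_pi_div_two_lt_arctan x])).trans exp_pi_div_four_le

lemma one_le_mul_exp_neg_arctan (x : ℝ) : 1 ≤ 2.2 * rexp (-arctan x / 2) := by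
  have h := exp_neg_arctan_le (-x)
  rw [arctan_neg, neg_neg] at h
  have h1 : rexp (-arctan x / 2) * rexp (arctan x / 2) = 1 := by
    rw [← Real.exp_add]
    ring_nf
    exact Real.exp_zero
  nlinarith [Real.exp_pos (-arctan x / 2)]

lemma weightedSize_sq_le (lam : ℤ → ℝ) {b η M : ℝ} (θ G : ℝ → ℤ → ℂ) {t : ℝ} {l : ℤ}
    (hM : ampSq b η l t ≤ M) :
    weightedSize lam b η θ G t l ^ 2
      ≤ 2.2 * M * (lam l ^ 2 * ‖θ t l‖ ^ 2 + lam l ^ 2 * ‖G t l‖ ^ 2) := by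
  have hA := one_le_ampSq b η l t
  rw [weightedSize, mul_pow, modeSize_sq, modeAmp_sq]
  have h1 : rexp (-arctan (t - η / (l : ℝ)) / 2) * ampSq b η l t ≤ 2.2 * M :=
    mul_le_mul (exp_neg_arctan_le _) hM (by linarith) (by norm_num)
  have h2 : ‖θ t l‖ ^ 2 + ‖G t l‖ ^ 2 / 4 ≤ ‖θ t l‖ ^ 2 + ‖G t l‖ ^ 2 := by
    nlinarith [sq_nonneg ‖G t l‖]
  calc _ = lam l ^ 2 * (rexp (-arctan (t - η / (l : ℝ)) / 2) * ampSq b η l t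
          * (‖θ t l‖ ^ 2 + ‖G t l‖ ^ 2 / 4)) := by ring
    _ ≤ lam l ^ 2 * (2.2 * M * (‖θ t l‖ ^ 2 + ‖G t l‖ ^ 2)) :=
        mul_le_mul_of_nonneg_left (mul_le_mul h1 h2 (by positivity)
          (by linarith)) (sq_nonneg _)
    _ = _ := by ring

lemma le_weightedSize_sq (lam : ℤ → ℝ) (b η : ℝ) (θ G : ℝ → ℤ → ℂ) (t : ℝ) (l : ℤ) :
    lam l ^ 2 * ‖θ t l‖ ^ 2 + lam l ^ 2 * ‖G t l‖ ^ 2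
      ≤ 8.8 * weightedSize lam b η θ G t l ^ 2 := by
  rw [weightedSize, mul_pow, modeSize_sq, modeAmp_sq]
  have h1 : 1 ≤ 2.2 * rexp (-arctan (t - η / (l : ℝ)) / 2) * ampSq b η l t :=
    one_le_mul_of_one_le_of_one_le (one_le_mul_exp_neg_arctan _) (one_le_ampSq b η l t)
  have h2 : 0 ≤ lam l ^ 2 * (‖θ t l‖ ^ 2 + ‖G t l‖ ^ 2 / 4) := by positivity
  nlinarith [mul_le_mul_of_nonneg_left h1 h2,
    mul_nonneg (sq_nonneg (lam l)) (sq_nonneg ‖θ t l‖)]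

lemma ampSq_le {b : ℝ} (hb : 0 ≤ b) (η : ℝ) (l : ℤ) (t : ℝ) : ampSq b η l t ≤ 1 + b ^ 2 := by
  unfold ampSq
  have h1 := pow_le_pow_left₀ (forcing_nonneg hb l) (forcing_le hb l) 2
  nlinarith [mul_le_mul h1 (lorentz_le_one η l t) (lorentz_pos η l t).le (sq_nonneg b)]

lemma ampSq_zero_le {c η : ℝ} (hc : 0 < c) (hc' : c < 0.001) (hη : 0 < η) (l : ℤ) :
    ampSq (c * η) η l 0 ≤ 2 := by
  rcases eq_or_ne l 0 with rfl | hl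
  · simp [ampSq, forcing]
  · have hl0 : (l : ℝ) ≠ 0 := by exact_mod_cast hl
    have hL := one_le_abs_cast hl
    have h1 := lorentz_div_sq_le hη hl 0
    have e1 : forcing (c * η) l ^ 2 * lorentz η l 0
        = (c * η) ^ 2 / |(l : ℝ)| ^ 4 * (lorentz η l 0 / (l : ℝ) ^ 2) := by
      unfold forcing
      rw [← sq_abs (l : ℝ)]
      field_simp
    have h2 : (c * η) ^ 2 / |(l : ℝ)| ^ 4 ≤ (c * η) ^ 2 :=
      div_le_self (sq_nonneg _) (one_le_pow₀ hL)
    have h3 := mul_le_mul h2 h1 (div_nonneg (lorentz_pos η l 0).le (sq_nonneg _)) (sq_nonneg _)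
    have e2 : (c * η) ^ 2 * ((1 + 0 ^ 2) / η ^ 2) = c ^ 2 := by
      field_simp
      ring
    unfold ampSq
    rw [e1]
    rw [e2] at h3
    nlinarith

lemma hasDerivAt_arctan_div_sqrt (η t : ℝ) :
    HasDerivAt (fun s => 1 / √(1 + η ^ 2) * arctan (s / √(1 + η ^ 2)))
      (1 / (1 + t ^ 2 + η ^ 2)) t := by
  have hs : 0 < √(1 + η ^ 2) := Real.sqrt_pos.2 (by positivity)
  have hs2 : √(1 + η ^ 2) ^ 2 = 1 + η ^ 2 := Real.sq_sqrt (by positivity)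
  have h := (((hasDerivAt_id t).div_const (√(1 + η ^ 2))).arctan).const_mul (1 / √(1 + η ^ 2))
  refine h.congr_deriv ?_
  simp only [id]
  have e : 1 + t ^ 2 + η ^ 2 = √(1 + η ^ 2) ^ 2 + t ^ 2 := by rw [hs2]; ring
  rw [e]
  field_simp

lemma mul_arctan_div_sqrt_le {η : ℝ} (hη : 0 < η) (t : ℝ) :
    η * (1 / √(1 + η ^ 2) * arctan (t / √(1 + η ^ 2))) ≤ 1.6 := by
  have hs : η ≤ √(1 + η ^ 2) := Real.le_sqrt_of_sq_le (by linarith)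
  have hs0 : 0 < √(1 + η ^ 2) := hη.trans_le hs
  have h1 : η * (1 / √(1 + η ^ 2)) ≤ 1 := by
    rw [mul_one_div]
    exact div_le_one_of_le₀ hs hs0.le
  have h2 : arctan (t / √(1 + η ^ 2)) ≤ 1.6 := by
    linarith [Real.arctan_lt_pi_div_two (t / √(1 + η ^ 2)), Real.pi_lt_d2]
  have h3 : 0 ≤ η * (1 / √(1 + η ^ 2)) := by positivity
  rw [← mul_assoc]
  nlinarith

lemma summable_weightedSize_sq {lam : ℤ → ℝ} {b η : ℝ} (hb : 0 ≤ b) {θ G : ℝ → ℤ → ℂ} {t : ℝ}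
    (hθ : Summable fun l : ℤ => (lam l) ^ 2 * ‖θ t l‖ ^ 2)
    (hG : Summable fun l : ℤ => (lam l) ^ 2 * ‖G t l‖ ^ 2) :
    Summable fun l => weightedSize lam b η θ G t l ^ 2 :=
  Summable.of_nonneg_of_le (fun _ => sq_nonneg _)
    (fun l => weightedSize_sq_le lam θ G (ampSq_le hb η l t)) ((hθ.add hG).mul_left _)

lemma tsum_weightedSize_sq_le {lam : ℤ → ℝ} {b η M : ℝ} (hb : 0 ≤ b) {θ G : ℝ → ℤ → ℂ} {t : ℝ}
    (hθ : Summable fun l : ℤ => (lam l) ^ 2 * ‖θ t l‖ ^ 2)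
    (hG : Summable fun l : ℤ => (lam l) ^ 2 * ‖G t l‖ ^ 2) (hM : ∀ l, ampSq b η l t ≤ M) :
    ∑' l, weightedSize lam b η θ G t l ^ 2
      ≤ 2.2 * M * (∑' l, lam l ^ 2 * ‖θ t l‖ ^ 2 + ∑' l, lam l ^ 2 * ‖G t l‖ ^ 2) := by
  rw [← hθ.tsum_add hG, ← tsum_mul_left]
  exact (summable_weightedSize_sq hb hθ hG).tsum_le_tsum
    (fun l => weightedSize_sq_le lam θ G (hM l)) ((hθ.add hG).mul_left _)

lemma le_tsum_weightedSize_sq {lam : ℤ → ℝ} {b η : ℝ} (hb : 0 ≤ b) {θ G : ℝ → ℤ → ℂ} {t : ℝ}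
    (hθ : Summable fun l : ℤ => (lam l) ^ 2 * ‖θ t l‖ ^ 2)
    (hG : Summable fun l : ℤ => (lam l) ^ 2 * ‖G t l‖ ^ 2) :
    ∑' l, lam l ^ 2 * ‖θ t l‖ ^ 2 + ∑' l, lam l ^ 2 * ‖G t l‖ ^ 2
      ≤ 8.8 * ∑' l, weightedSize lam b η θ G t l ^ 2 := by
  rw [← hθ.tsum_add hG, ← tsum_mul_left]
  exact (hθ.add hG).tsum_le_tsum (fun l => le_weightedSize_sq lam b η θ G t l)
    ((summable_weightedSize_sq hb hθ hG).mul_left _)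

lemma hasDerivAt_deriv_weightedSize_sq {ν c η : ℝ} (hν : 0 < ν) (hc : 0 < c) (hc' : c < 0.001)
    (hη : 0 < η) {f : ℝ → ℝ} (hfb : ∀ t : ℝ, 0 ≤ t → |f t| ≤ 4 * c / (1 + t ^ 2))
    {θ G : ℝ → ℤ → ℂ} (hsol : IsWaveSol ν c η f θ G) {lam : ℤ → ℝ} (hlam : GoodWeight lam)
    (l : ℤ) (t : ℝ) :
    HasDerivAt (fun s => weightedSize lam (c * η) η θ G s l ^ 2)
      (deriv (fun s => weightedSize lam (c * η) η θ G s l ^ 2) t) t ∧ (0 ≤ t →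
      deriv (fun s => weightedSize lam (c * η) η θ G s l ^ 2) t
      ≤ 2 * modeDens (c * η) η l t * weightedSize lam (c * η) η θ G t l ^ 2
        + (24.75 * modeDens (c * η) η (l + 1) t + 0.01 * modeDens (c * η) η l t
          + 10 * (8 * (c * η) / (1 + t ^ 2 + η ^ 2)))
          * (weightedSize lam (c * η) η θ G t l * weightedSize lam (c * η) η θ G t (l + 1))
        + (24.75 * modeDens (c * η) η (l - 1) t + 0.01 * modeDens (c * η) η l t
          + 10 * (8 * (c * η) / (1 + t ^ 2 + η ^ 2)))
          * (weightedSize lam (c * η) η θ G t l * weightedSize lam (c * η) η θ G t (l - 1))) := by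
  have hb : 0 ≤ c * η := by positivity
  rcases eq_or_ne l 0 with rfl | hl
  · have h0 (s : ℝ) : weightedSize lam (c * η) η θ G s 0 = 0 := by
      simp [weightedSize, modeSize, hsol.1 s, hsol.2.1 s]
    simp [h0, hasDerivAt_const]
  · obtain ⟨D, hD, hle⟩ :=
      exists_hasDerivAt_weightedSize_sq hν hc hc' hη hfb hsol hlam hl t
    rw [hD.deriv]
    refine ⟨hD, fun ht => (hle ht).trans ?_⟩
    have hr := resRate_le_modeDens hb η
    have he := weightedSize_nonneg hlam.1 (c * η) η θ G t
    have := he l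
    have := he (l + 1)
    have := he (l - 1)
    gcongr
    all_goals exact hr _ _

/-- Growth of the weighted energy is controlled by the total resonant growth. -/
lemma tsum_weightedSize_sq_le_exp {ν c η : ℝ} (hν : 0 < ν) (hc : 0 < c) (hc' : c < 0.001)
    (hη : 0 < η) {f : ℝ → ℝ} (hfb : ∀ t : ℝ, 0 ≤ t → |f t| ≤ 4 * c / (1 + t ^ 2))
    {θ G : ℝ → ℤ → ℂ} (hsol : IsWaveSol ν c η f θ G) {lam : ℤ → ℝ} (hlam : GoodWeight lam)
    (hθsum : ∀ t : ℝ, Summable fun l : ℤ => (lam l) ^ 2 * ‖θ t l‖ ^ 2)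
    (hGsum : ∀ t : ℝ, Summable fun l : ℤ => (lam l) ^ 2 * ‖G t l‖ ^ 2)
    (hθ : Continuous fun s => ∑' l : ℤ, (lam l) ^ 2 * ‖θ s l‖ ^ 2)
    (hG : Continuous fun s => ∑' l : ℤ, (lam l) ^ 2 * ‖G s l‖ ^ 2) {T : ℝ} (hT : 0 ≤ T) :
    ∑' l, weightedSize lam (c * η) η θ G T l ^ 2
      ≤ rexp (19.6 * ∑' k, modePrim (c * η) η k T
          + 160 * (c * η) * (1 / √(1 + η ^ 2) * arctan (T / √(1 + η ^ 2))))
        * ∑' l, weightedSize lam (c * η) η θ G 0 l ^ 2 := by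
  have hb : 0 ≤ c * η := by positivity
  have hsum (t : ℝ) : Summable fun l => weightedSize lam (c * η) η θ G t l ^ 2 :=
    summable_weightedSize_sq hb (hθsum t) (hGsum t)
  obtain ⟨C, hC⟩ := (isCompact_Icc (a := (0 : ℝ)) (b := T)).exists_bound_of_continuousOn
    (((hθ.add hG).const_smul (2.2 * (1 + (c * η) ^ 2))).continuousOn)
  refine gronwall_of_isLUB (T := T) (C := C)
    (F := fun (s : Finset ℤ) t => ∑ l ∈ s, weightedSize lam (c * η) η θ G t l ^ 2)
    (F' := fun s t => ∑ l ∈ s, deriv (fun s => weightedSize lam (c * η) η θ G s l ^ 2) t)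
    (E := fun t => ∑' l, weightedSize lam (c * η) η θ G t l ^ 2)
    (Φ := fun t => 19.6 * ∑' k, modePrim (c * η) η k t
          + 160 * (c * η) * (1 / √(1 + η ^ 2) * arctan (t / √(1 + η ^ 2))))
    (K := fun t => 19.6 * ∑' k, modeDens (c * η) η k t
      + 160 * (c * η) * (1 / (1 + t ^ 2 + η ^ 2)))
    hT (fun t => tsum_nonneg fun l => sq_nonneg _) (fun t ht => ?_)
    (fun t => isLUB_hasSum (fun _ => sq_nonneg _) (hsum t).hasSum)
    (fun s t => HasDerivAt.fun_sum fun l _ =>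
      (hasDerivAt_deriv_weightedSize_sq hν hc hc' hη hfb hsol hlam l t).1)
    (fun s t ht => ?_)
    (fun t => ((hasDerivAt_tsum_modePrim hb η t).const_mul _).add
      ((hasDerivAt_arctan_div_sqrt η t).const_mul _))
    (fun t => ?_) ?_
  · exact (tsum_weightedSize_sq_le hb (hθsum t) (hGsum t) fun l => ampSq_le hb η l t).trans
      ((le_abs_self _).trans (hC t ht))
  · have hd : 0 ≤ ∑' k, modeDens (c * η) η k t := tsum_nonneg fun k => modeDens_nonneg hb η k t
    have hE : 0 ≤ ∑' l, weightedSize lam (c * η) η θ G t l ^ 2 := tsum_nonneg fun l => sq_nonneg _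
    refine (Finset.sum_le_sum fun l _ =>
      (hasDerivAt_deriv_weightedSize_sq hν hc hc' hη hfb hsol hlam l t).2 ht).trans
      ((sum_neighbour_le (weightedSize_nonneg hlam.1 (c * η) η θ G t)
        (fun k => modeDens_nonneg hb η k t) (by norm_num) (by norm_num) (by positivity)
        (summable_modeDens hb η t) (hsum t).hasSum s).trans
        (mul_le_mul_of_nonneg_right ?_ hE))
    have e : 2 * (10 * (8 * (c * η) / (1 + t ^ 2 + η ^ 2)))
        = 160 * (c * η) * (1 / (1 + t ^ 2 + η ^ 2)) := by ring
    rw [e]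
    nlinarith
  · have hd : 0 ≤ ∑' k, modeDens (c * η) η k t := tsum_nonneg fun k => modeDens_nonneg hb η k t
    positivity
  · simp [modePrim_zero]

lemma growth_exponent_le {c η : ℝ} (hc : 0 < c) (hc' : c < 0.001) (hη : 0 < η)
    (hlarge : 1 / 1000 ≤ c * η) {t : ℝ} (ht : 0 ≤ t) :
    19.6 * ∑' k, modePrim (c * η) η k t
        + 160 * (c * η) * (1 / √(1 + η ^ 2) * arctan (t / √(1 + η ^ 2)))
      ≤ 400 * (c * η) ^ ((1 : ℝ) / 3) := by
  set B := (c * η) ^ ((1 : ℝ) / 3) with hB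
  have hb : 0 < c * η := by positivity
  have hB0 : 0 < B := Real.rpow_pos_of_pos hb _
  have hB3 : B ^ 3 = c * η := by
    rw [hB, ← Real.rpow_natCast, ← Real.rpow_mul hb.le]
    norm_num
  have hB1 : 0.1 ≤ B := by
    refine le_of_pow_le_pow_left₀ (n := 3) (by norm_num) hB0.le ?_
    rw [hB3]
    norm_num at hlarge ⊢
    exact hlarge
  have h1 := tsum_modePrim_le hc hη hB0 hB3 ht
  have h2 := mul_le_mul_of_nonneg_left (mul_arctan_div_sqrt_le hη t) hc.le
  linarith

/-- **Global Gevrey-3 stability at fixed frequency `η`.** If `0 < c < 0.001` and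
`cη ≥ 1/1000`, then every solution of the wave perturbation system with finite `X`-norms
satisfies, for all `t ≥ 0`,
`‖θ(t)‖_X + ‖G(t)‖_X ≤ 4000·exp(200(cη)^{1/3})·(‖θ(0)‖_X + ‖G(0)‖_X)`. -/
theorem global_gevrey3_stability
    (ν c η : ℝ) (hν : 0 < ν) (hc : 0 < c) (hc' : c < 0.001) (hη : 0 < η)
    (hlarge : 1 / 1000 ≤ c * η)
    (f : ℝ → ℝ) (hf : Continuous f)
    (hfb : ∀ t : ℝ, 0 ≤ t → |f t| ≤ 4 * c / (1 + t ^ 2))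
    (θ G : ℝ → ℤ → ℂ) (hsol : IsWaveSol ν c η f θ G)
    (lam : ℤ → ℝ) (hlam : GoodWeight lam)
    (hθsum : ∀ t : ℝ, Summable fun l : ℤ => (lam l) ^ 2 * ‖θ t l‖ ^ 2)
    (hGsum : ∀ t : ℝ, Summable fun l : ℤ => (lam l) ^ 2 * ‖G t l‖ ^ 2)
    (hθderiv : ∀ t : ℝ, HasDerivAt (fun s => ∑' l : ℤ, (lam l) ^ 2 * ‖θ s l‖ ^ 2)
        (∑' l : ℤ, (lam l) ^ 2 * deriv (fun s => ‖θ s l‖ ^ 2) t) t)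
    (hGderiv : ∀ t : ℝ, HasDerivAt (fun s => ∑' l : ℤ, (lam l) ^ 2 * ‖G s l‖ ^ 2)
        (∑' l : ℤ, (lam l) ^ 2 * deriv (fun s => ‖G s l‖ ^ 2) t) t)
    (hIPderiv : ∀ t : ℝ, HasDerivAt
        (fun s => ∑' l : ℤ, (lam l) ^ 2 * ((starRingEnd ℂ) (θ s l) * G s l).re)
        (∑' l : ℤ, (lam l) ^ 2 * deriv (fun s => ((starRingEnd ℂ) (θ s l) * G s l).re) t)
        t) :
    ∀ t : ℝ, 0 ≤ t →
      Xnorm lam (θ t) + Xnorm lam (G t)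
        ≤ 4000 * Real.exp (200 * (c * η) ^ ((1 : ℝ) / 3))
            * (Xnorm lam (θ 0) + Xnorm lam (G 0)) := by
  intro t ht
  have hb : 0 ≤ c * η := by positivity
  have hE := tsum_weightedSize_sq_le_exp hν hc hc' hη hfb hsol hlam hθsum hGsum
    (continuous_iff_continuousAt.2 fun s => (hθderiv s).continuousAt)
    (continuous_iff_continuousAt.2 fun s => (hGderiv s).continuousAt) ht
  have hΦ := Real.exp_le_exp.2 (growth_exponent_le hc hc' hη hlarge ht)
  have hlow := le_tsum_weightedSize_sq (η := η) hb (hθsum t) (hGsum t)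
  have hup := tsum_weightedSize_sq_le hb (hθsum 0) (hGsum 0)
    (fun l => ampSq_zero_le hc hc' hη l)
  have hE0 : 0 ≤ ∑' l, weightedSize lam (c * η) η θ G 0 l ^ 2 := tsum_nonneg fun l => sq_nonneg _
  have hX (u : ℤ → ℂ) : Xnorm lam u ^ 2 = ∑' l, lam l ^ 2 * ‖u l‖ ^ 2 :=
    Real.sq_sqrt (tsum_nonneg fun l => by positivity)
  have hX0 (u : ℤ → ℂ) : 0 ≤ Xnorm lam u := Real.sqrt_nonneg _
  rw [← hX, ← hX] at hlow hup
  set g := rexp (200 * (c * η) ^ ((1 : ℝ) / 3)) with hg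
  have hg0 : 0 < g := Real.exp_pos _
  have hg2 : rexp (400 * (c * η) ^ ((1 : ℝ) / 3)) = g ^ 2 := by
    rw [hg, ← Real.exp_nat_mul]
    push_cast
    ring_nf
  rw [hg2] at hΦ
  have h1 := hE.trans (mul_le_mul_of_nonneg_right hΦ hE0)
  have h2 := mul_le_mul_of_nonneg_left hup (sq_nonneg g)
  have a1 := hX0 (θ t)
  have a2 := hX0 (G t)
  have a3 := hX0 (θ 0)
  have a4 := hX0 (G 0)
  have h3 : Xnorm lam (θ t) ^ 2 + Xnorm lam (G t) ^ 2
      ≤ 40 * (g * (Xnorm lam (θ 0) + Xnorm lam (G 0))) ^ 2 := by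
    have h4 : 0 ≤ g ^ 2 * (Xnorm lam (θ 0) * Xnorm lam (G 0)) := by positivity
    have h5 : 0 ≤ g ^ 2 * (Xnorm lam (θ 0) ^ 2 + Xnorm lam (G 0) ^ 2) := by positivity
    nlinarith
  have h6 : 0 ≤ g * (Xnorm lam (θ 0) + Xnorm lam (G 0)) := by positivity
  rw [mul_assoc]
  refine (abs_le_of_sq_le_sq' ?_ (by positivity)).2
  nlinarith [sq_nonneg (Xnorm lam (θ t) - Xnorm lam (G t)),
    sq_nonneg (g * (Xnorm lam (θ 0) + Xnorm lam (G 0)))]
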